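/- Let P_Z be a probability distribution on ℝ defining a BMS channel in multiplicative-noise form with capacity C ∈ (0,1). Fix integers 0 ≤ r ≤ m with m ≥ 1 and set N = 2^m. Let X be uniformly distributed on the BPSK image of the Reed–Muller code RM(r,m), let Z ∈ ℝ^N have i.i.d. components with law P_Z independent of X, and let Y = X ⊙ Z. If R(r,m) < C, then for every i ∈ {0,…,N−1}, BER(X_i | Y) ≤ (ρ(m)/2)/(C − R(r,m)), where ρ(m) := (6 ln m + 34)/(5 √m). -/

import Mathlib

open MeasureTheory ProbabilityTheory

noncomputable section

/-- The binary entropy function (base 2). -/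
def hb (p : ℝ) : ℝ := -(p * Real.logb 2 p) - (1 - p) * Real.logb 2 (1 - p)

/-- Conditional expectation `E[X | W]` of `X` given the σ-algebra generated by `W`. -/
def condMean {Ω β E : Type*} [MeasurableSpace Ω] [MeasurableSpace β]
    [NormedAddCommGroup E] [NormedSpace ℝ E] [CompleteSpace E]
    (μ : Measure Ω) (X : Ω → E) (W : Ω → β) : Ω → E :=
  μ[X | MeasurableSpace.comap W inferInstance]

/-- Bit-error probability of the MAP decision rule for `X ∈ {±1}` given `W`. -/
def BER {Ω β : Type*} [MeasurableSpace Ω] [MeasurableSpace β]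
    (μ : Measure Ω) (X : Ω → ℝ) (W : Ω → β) : ℝ :=
  (1 - ∫ ω, |condMean μ X W ω| ∂μ) / 2

/-- Minimum mean squared error of estimating `X` from `W`. -/
def mmse {Ω β : Type*} [MeasurableSpace Ω] [MeasurableSpace β]
    (μ : Measure Ω) (X : Ω → ℝ) (W : Ω → β) : ℝ :=
  ∫ ω, (X ω - condMean μ X W ω) ^ 2 ∂μ

/-- Uniform distribution on `{-1, 1} ⊆ ℝ`. -/
def signMeasure : Measure ℝ := (2 : ENNReal)⁻¹ • (Measure.dirac (-1) + Measure.dirac 1)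

/-- Capacity of the BMS channel (in multiplicative-noise form) with noise law `PZ`:
`C = 1 - E[h_b((1 + E[X_u | Y_u])/2)]` where `X_u` is uniform on `{±1}`, independent of
`Z₀ ~ PZ`, and `Y_u = X_u · Z₀`. -/
def capacity (PZ : Measure ℝ) : ℝ :=
  1 - ∫ p, hb ((1 + condMean (signMeasure.prod PZ)
        (fun q : ℝ × ℝ => q.1) (fun q : ℝ × ℝ => q.1 * q.2) p) / 2) ∂(signMeasure.prod PZ)

/-- Evaluation vector of the multilinear polynomial whose coefficients on monomials
of degree at most `r` are given by `α` (higher-degree coefficients being ignored),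
evaluated at the point `v ∈ 𝔽₂^m` with index `i = Σ_j v_j 2^j`. -/
def RMword (r m : ℕ) (α : Finset (Fin m) → ZMod 2) : Fin (2 ^ m) → ZMod 2 :=
  fun i => ∑ S ∈ Finset.univ.filter (fun S : Finset (Fin m) => S.card ≤ r),
    α S * ∏ j ∈ S, ((((i : ℕ) / 2 ^ (j : ℕ)) % 2 : ℕ) : ZMod 2)

/-- The Reed–Muller code RM(r, m) ⊆ 𝔽₂^{2^m}. -/
def RMcode (r m : ℕ) : Finset (Fin (2 ^ m) → ZMod 2) :=
  Finset.image (RMword r m) Finset.univ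

/-- The rate `R(r,m)` of RM(r,m). -/
def RMrate (r m : ℕ) : ℝ := (2 ^ m : ℝ)⁻¹ * ∑ i ∈ Finset.range (r + 1), (m.choose i : ℝ)

/-- BPSK modulation map `c ↦ ((-1)^{c_0}, …, (-1)^{c_{N-1}})`. -/
def bpsk {N : ℕ} (c : Fin N → ZMod 2) : Fin N → ℝ := fun i => (-1 : ℝ) ^ ((c i).val)

/-- BPSK image of a binary code. -/
def bpskImage {N : ℕ} (C : Finset (Fin N → ZMod 2)) : Finset (Fin N → ℝ) :=
  letI := Classical.decEq (Fin N → ℝ)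
  C.image bpsk

/-- BPSK image of RM(r,m). -/
def bpskRM (r m : ℕ) : Finset (Fin (2 ^ m) → ℝ) := bpskImage (RMcode r m)

/-- Uniform probability measure on a finite set. -/
def uniformOnFinset {α : Type*} [MeasurableSpace α] (s : Finset α) : Measure α :=
  (s.card : ENNReal)⁻¹ • ∑ x ∈ s, Measure.dirac x

/-- `ρ(m) = (6 ln m + 34)/(5 √m)`. -/
def rho (m : ℕ) : ℝ := (6 * Real.log m + 34) / (5 * Real.sqrt m)

/-- Inverse of the binary entropy function restricted to `[0, 1/2]`. -/
def hbInv (u : ℝ) : ℝ := sSup {p : ℝ | p ∈ Set.Icc (0 : ℝ) (1 / 2) ∧ hb p ≤ u}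

/-- `ψ(u) = 1 - (1 - 2 h_b^{-1}(u))²`. -/
def psi (u : ℝ) : ℝ := 1 - (1 - 2 * hbInv u) ^ 2

/-- `Ψ(u) = ∫₀^u ψ(v) dv`. -/
def PsiInt (u : ℝ) : ℝ := ∫ v in (0 : ℝ)..u, psi v

/-- The coefficients `c_k = 1/(ln 2 · 2k (2k-1))`. -/
def ck (k : ℕ) : ℝ := 1 / (Real.log 2 * (2 * k) * (2 * k - 1))

/-- The channel moments `q_k = E[(E[X_u | Y_u])^{2k}]` for uniform input. -/
def qmom (PZ : Measure ℝ) (k : ℕ) : ℝ :=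
  ∫ p, (condMean (signMeasure.prod PZ)
      (fun q : ℝ × ℝ => q.1) (fun q : ℝ × ℝ => q.1 * q.2) p) ^ (2 * k) ∂(signMeasure.prod PZ)

end

open MeasureTheory ProbabilityTheory
namespace RMP
noncomputable section

/-- Symmetrised relative entropy function. -/
def phi (x : ℝ) : ℝ := ((1 + x) * Real.log (1 + x) + (1 - x) * Real.log (1 - x)) / 2

lemma continuous_phi : Continuous phi := by
  unfold phi
  have h := Real.continuous_mul_log
  have h1 : Continuous fun x : ℝ => (1 + x) * Real.log (1 + x) :=
    h.comp (continuous_const.add continuous_id)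
  have h2 : Continuous fun x : ℝ => (1 - x) * Real.log (1 - x) :=
    h.comp (continuous_const.sub continuous_id)
  exact (h1.add h2).div_const 2

lemma phi_zero : phi 0 = 0 := by simp [phi]

lemma phi_neg (x : ℝ) : phi (-x) = phi x := by
  unfold phi
  rw [sub_neg_eq_add, ← sub_eq_add_neg]; ring

lemma mul_log_le {y : ℝ} (hy : 0 ≤ y) : y * Real.log y ≤ y * (y - 1) := by
  rcases hy.eq_or_lt with rfl | h
  · simp
  · exact mul_le_mul_of_nonneg_left (Real.log_le_sub_one_of_pos h) hy

lemma phi_le_sq {x : ℝ} (hx : |x| ≤ 1) : phi x ≤ x ^ 2 := by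
  rw [abs_le] at hx
  have h1 := mul_log_le (y := 1 + x) (by linarith)
  have h2 := mul_log_le (y := 1 - x) (by linarith)
  unfold phi
  nlinarith

lemma hasDerivAt_k {x : ℝ} (h1 : -1 < x) (h2 : x < 1) :
    HasDerivAt (fun x => phi x - x ^ 2 / 2) ((Real.log (1 + x) - Real.log (1 - x)) / 2 - x) x := by
  have a1 : HasDerivAt (fun x : ℝ => 1 + x) 1 x := (hasDerivAt_id x).const_add 1
  have a2 : HasDerivAt (fun x : ℝ => 1 - x) (-1) x := (hasDerivAt_id x).const_sub 1
  have n1 : (1 + x) ≠ 0 := by linarith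
  have n2 : (1 - x) ≠ 0 := by linarith
  have b1 := a1.mul (a1.log n1)
  have b2 := a2.mul (a2.log n2)
  have c := ((b1.add b2).div_const 2).sub (((hasDerivAt_id x).pow 2).div_const 2)
  refine c.congr_deriv ?_
  simp only [id]
  field_simp
  ring

lemma hasDerivAt_k' {x : ℝ} (h1 : -1 < x) (h2 : x < 1) :
    HasDerivAt (fun x => (Real.log (1 + x) - Real.log (1 - x)) / 2 - x)
      ((1 / (1 + x) + 1 / (1 - x)) / 2 - 1) x := by
  have a1 : HasDerivAt (fun x : ℝ => 1 + x) 1 x := (hasDerivAt_id x).const_add 1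
  have a2 : HasDerivAt (fun x : ℝ => 1 - x) (-1) x := (hasDerivAt_id x).const_sub 1
  have n1 : (1 + x) ≠ 0 := by linarith
  have n2 : (1 - x) ≠ 0 := by linarith
  have c := (((a1.log n1).sub (a2.log n2)).div_const 2).sub (hasDerivAt_id x)
  refine c.congr_deriv ?_
  ring

lemma convex_k : ConvexOn ℝ (Set.Icc (-1) 1) (fun x => phi x - x ^ 2 / 2) := by
  refine convexOn_of_hasDerivWithinAt2_nonneg (f' := fun x => (Real.log (1 + x) - Real.log (1 - x)) / 2 - x)
    (f'' := fun x => (1 / (1 + x) + 1 / (1 - x)) / 2 - 1) (convex_Icc _ _) ?_ ?_ ?_ ?_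
  · exact (continuous_phi.sub ((continuous_id.pow 2).div_const 2)).continuousOn
  · intro x hx
    rw [interior_Icc] at hx
    exact (hasDerivAt_k hx.1 hx.2).hasDerivWithinAt
  · intro x hx
    rw [interior_Icc] at hx
    exact (hasDerivAt_k' hx.1 hx.2).hasDerivWithinAt
  · intro x hx
    rw [interior_Icc] at hx
    have h1 : 0 < 1 + x := by linarith [hx.1]
    have h2 : 0 < 1 - x := by linarith [hx.2]
    have : (1 / (1 + x) + 1 / (1 - x)) / 2 - 1 = x ^ 2 / ((1 + x) * (1 - x)) := by
      field_simp; ring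
    simp only [this]; positivity

/-- strong convexity of `phi` -/
lemma phi_tangent {x y : ℝ} (hx : |x| ≤ 1) (hy : |y| < 1) :
    phi y + (Real.log (1 + y) - Real.log (1 - y)) / 2 * (x - y) + (x - y) ^ 2 / 2 ≤ phi x := by
  rw [abs_le] at hx
  rw [abs_lt] at hy
  have hd := hasDerivAt_k hy.1 hy.2
  have hxm : x ∈ Set.Icc (-1 : ℝ) 1 := ⟨hx.1, hx.2⟩
  have hym : y ∈ Set.Icc (-1 : ℝ) 1 := ⟨hy.1.le, hy.2.le⟩
  rcases lt_trichotomy x y with h | h | h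
  · have := convex_k.slope_le_of_hasDerivAt hxm hym h hd
    rw [slope_def_field, div_le_iff₀ (by linarith)] at this
    nlinarith
  · subst h; simp
  · have := convex_k.le_slope_of_hasDerivAt hym hxm h hd
    rw [slope_def_field, le_div_iff₀ (by linarith)] at this
    nlinarith

lemma phi_nonneg {x : ℝ} (hx : |x| ≤ 1) : 0 ≤ phi x := by
  have := phi_tangent (y := 0) hx (by simp)
  simp [phi_zero] at this
  nlinarith [sq_nonneg x]

lemma abs_phi_le {x : ℝ} (hx : |x| ≤ 1) : |phi x| ≤ 1 := by
  rw [abs_of_nonneg (phi_nonneg hx)]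
  refine (phi_le_sq hx).trans ?_
  exact (sq_le_one_iff_abs_le_one x).2 hx

/-- binomial bound -/
lemma cb_bound (k : ℕ) : (Nat.centralBinom k) ^ 2 * (2 * k + 1) ≤ 16 ^ k := by
  induction k with
  | zero => simp
  | succ k ih =>
    have h := Nat.succ_mul_centralBinom_succ k
    have h2 : (k+1)^2 * ((Nat.centralBinom (k+1)) ^ 2 * (2 * (k+1) + 1)) ≤ (k+1)^2 * 16 ^ (k+1) := by
      calc (k+1)^2 * ((Nat.centralBinom (k+1)) ^ 2 * (2 * (k+1) + 1))
          = ((k+1) * Nat.centralBinom (k+1)) ^ 2 * (2 * (k+1) + 1) := by ring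
        _ = (Nat.centralBinom k ^ 2 * (2 * k + 1)) * (4 * ((2 * k + 1) * (2 * k + 3))) := by
            rw [h]; ring
        _ ≤ 16 ^ k * (4 * ((2 * k + 1) * (2 * k + 3))) := Nat.mul_le_mul_right _ ih
        _ ≤ 16 ^ k * (16 * (k+1)^2) := Nat.mul_le_mul_left _ (by nlinarith)
        _ = (k+1)^2 * 16 ^ (k+1) := by ring
    exact Nat.le_of_mul_le_mul_left h2 (by positivity)

lemma choose_bound (n r : ℕ) : (n.choose r) ^ 2 * (n + 1) ≤ 4 ^ n := by
  have h0 := Nat.choose_le_middle r n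
  have h1 : (n.choose r) ^ 2 * (n + 1) ≤ (n.choose (n/2)) ^ 2 * (n + 1) :=
    Nat.mul_le_mul_right _ (Nat.pow_le_pow_left h0 2)
  refine h1.trans ?_
  rcases Nat.even_or_odd' n with ⟨k, rfl | rfl⟩
  · have : 2 * k / 2 = k := by omega
    rw [this, pow_mul]
    exact cb_bound k
  · have e : (2 * k + 1) / 2 = k := by omega
    rw [e]
    have h2 : 2 * (2 * k + 1).choose k = Nat.centralBinom (k+1) := by
      rw [Nat.centralBinom, show 2 * (k+1) = (2 * k + 1) + 1 by ring, Nat.choose_succ_succ']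
      have : (2 * k + 1).choose (k+1) = (2*k+1).choose k := by
        rw [Nat.choose_symm_half]
      omega
    have h3 := cb_bound (k+1)
    rw [← h2] at h3
    have : (16:ℕ) ^ (k+1) = 4 * 4 ^ (2 * k + 1) := by
      rw [show (16:ℕ) = 4^2 by norm_num, ← pow_mul]; ring
    nlinarith

lemma binom_real (m r : ℕ) (hm : 1 ≤ m) :
    9 * (((m-1).choose r : ℕ) : ℝ) / 2 ^ m ≤ 34 / (5 * Real.sqrt m) := by
  obtain ⟨n, rfl⟩ : ∃ n, m = n + 1 := ⟨m - 1, by omega⟩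
  simp only [Nat.add_sub_cancel]
  have h := choose_bound n r
  have h' : ((n.choose r : ℕ) : ℝ) ^ 2 * (n + 1) ≤ 4 ^ n := by exact_mod_cast h
  have hs : 0 < Real.sqrt ((n + 1 : ℕ) : ℝ) := Real.sqrt_pos.2 (by positivity)
  have hs2 : Real.sqrt ((n + 1 : ℕ) : ℝ) ^ 2 = n + 1 := by
    rw [Real.sq_sqrt (by positivity)]; push_cast; ring
  have : ((n.choose r : ℕ) : ℝ) * Real.sqrt ((n + 1 : ℕ) : ℝ) ≤ 2 ^ n := by
    refine le_of_sq_le_sq ?_ (by positivity)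
    rw [mul_pow, hs2, ← pow_mul, mul_comm n 2, pow_mul]; norm_num; exact h'
  rw [div_le_div_iff₀ (by positivity) (by positivity)]
  rw [pow_succ]
  nlinarith [pow_pos (show (0:ℝ) < 2 by norm_num) n]

end
end RMP

open MeasureTheory ProbabilityTheory
set_option linter.unusedSectionVars false
namespace RMP
noncomputable section

/-- An odd measurable map to `[-1,1]`. -/
structure Ker (κ : ℝ → ℝ) : Prop where
  meas : Measurable κ
  odd : ∀ w, κ (-w) = -κ w
  bd : ∀ w, |κ w| ≤ 1

lemma Ker.zero {κ : ℝ → ℝ} (h : Ker κ) : κ 0 = 0 := by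
  have := h.odd 0
  simp at this; linarith

lemma Ker.nonneg {κ : ℝ → ℝ} (h : Ker κ) (w : ℝ) : 0 ≤ 1 + κ w := by
  have := abs_le.1 (h.bd w); linarith [this.1]

/-- symmetric reference measure and channel measure -/
structure BMS (κ : ℝ → ℝ) (l P : Measure ℝ) : Prop where
  ker : Ker κ
  symm : l.map Neg.neg = l
  dens : P = l.withDensity (fun w => ENNReal.ofReal (1 + κ w))

/-- mixture with an erasure -/
def mix (t : unitInterval) (μ : Measure ℝ) : Measure ℝ :=
  ENNReal.ofReal (t : ℝ) • μ + ENNReal.ofReal (1 - (t : ℝ)) • Measure.dirac 0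

lemma ofReal_t_add (t : unitInterval) :
    ENNReal.ofReal (t : ℝ) + ENNReal.ofReal (1 - (t : ℝ)) = 1 := by
  rw [← ENNReal.ofReal_add t.2.1 (by linarith [t.2.2])]; simp

instance (t : unitInterval) (μ : Measure ℝ) [IsProbabilityMeasure μ] :
    IsProbabilityMeasure (mix t μ) := ⟨by simp [mix, ofReal_t_add t]⟩

lemma mix_one (μ : Measure ℝ) : mix 1 μ = μ := by simp [mix]
lemma mix_zero (μ : Measure ℝ) : mix 0 μ = Measure.dirac 0 := by simp [mix]

lemma BMS.mix {κ : ℝ → ℝ} {l P : Measure ℝ} (h : BMS κ l P) (t : unitInterval) :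
    BMS κ (RMP.mix t l) (RMP.mix t P) where
  ker := h.ker
  symm := by
    unfold RMP.mix
    rw [Measure.map_add _ _ measurable_neg, Measure.map_smul, Measure.map_smul, h.symm,
      Measure.map_dirac' (f := Neg.neg) measurable_neg (0:ℝ)]
    simp
  dens := by
    have hm : Measurable (fun w => ENNReal.ofReal (1 + κ w)) :=
      (h.ker.meas.const_add 1).ennreal_ofReal
    unfold RMP.mix
    rw [withDensity_add_measure, withDensity_smul_measure, withDensity_smul_measure, ← h.dens]
    congr 2
    ext s hs
    classical
    rw [withDensity_apply _ hs, setLIntegral_dirac' hm hs, Measure.dirac_apply' _ hs, h.ker.zero]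
    simp [Set.indicator]

variable {ι : Type*} [Fintype ι] [DecidableEq ι]

/-- product of erased channels -/
def piM (t : ι → unitInterval) (μ : Measure ℝ) : Measure (ι → ℝ) :=
  Measure.pi (fun i => mix (t i) μ)

instance (t : ι → unitInterval) (μ : Measure ℝ) [IsProbabilityMeasure μ] :
    IsProbabilityMeasure (piM t μ) := by unfold piM; infer_instance


lemma pi_withDensity (l : ι → Measure ℝ) [∀ i, IsProbabilityMeasure (l i)]
    (f : ℝ → ENNReal) (hf : Measurable f) [∀ i, SigmaFinite ((l i).withDensity f)] :
    Measure.pi (fun i => (l i).withDensity f)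
      = (Measure.pi l).withDensity (fun w => ∏ i, f (w i)) := by
  refine Measure.pi_eq ?_
  intro s hs
  rw [withDensity_apply _ (MeasurableSet.univ_pi hs), ← lintegral_indicator (MeasurableSet.univ_pi hs)]
  have h1 : (Set.pi Set.univ s).indicator (fun w : ι → ℝ => ∏ i, f (w i))
      = fun w => ∏ i, (s i).indicator f (w i) := by
    funext w
    by_cases hw : w ∈ Set.pi Set.univ s
    · rw [Set.indicator_of_mem hw]
      exact Finset.prod_congr rfl fun i _ => by rw [Set.indicator_of_mem (hw i (Set.mem_univ i))]
    · rw [Set.indicator_of_notMem hw]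
      simp only [Set.mem_pi, Set.mem_univ, forall_true_left, not_forall] at hw
      obtain ⟨i, hi⟩ := hw
      exact (Finset.prod_eq_zero (Finset.mem_univ i) (Set.indicator_of_notMem hi _)).symm
  rw [h1]
  have hind := iIndepFun_pi (μ := l) (X := fun i => (s i).indicator f)
    (fun i => (hf.indicator (hs i)).aemeasurable)
  rw [lintegral_prod_eq_prod_lintegral_of_indepFun Finset.univ _ hind
    (fun i => (hf.indicator (hs i)).comp (measurable_pi_apply i))]
  refine Finset.prod_congr rfl fun i _ => ?_
  have := (measurePreserving_eval l i).lintegral_comp (hf.indicator (hs i))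
  simp only [Function.eval] at this
  rw [this, lintegral_indicator (hs i), withDensity_apply _ (hs i)]

/-- density of the product channel -/
def dens (κ : ℝ → ℝ) (w : ι → ℝ) : ℝ := ∏ i, (1 + κ (w i))

lemma dens_nonneg {κ : ℝ → ℝ} (h : Ker κ) (w : ι → ℝ) : 0 ≤ dens κ w :=
  Finset.prod_nonneg fun i _ => h.nonneg (w i)

lemma measurable_dens {κ : ℝ → ℝ} (h : Ker κ) : Measurable (dens κ : (ι → ℝ) → ℝ) := by
  unfold dens
  exact Finset.measurable_prod _ fun i _ => ((h.meas.comp (measurable_pi_apply i)).const_add 1)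

lemma piM_dens {κ : ℝ → ℝ} {l P : Measure ℝ} [IsProbabilityMeasure l] [IsProbabilityMeasure P]
    (h : BMS κ l P) (t : ι → unitInterval) :
    piM t P = (piM t l).withDensity (fun w => ENNReal.ofReal (dens κ w)) := by
  have hm : Measurable (fun w => ENNReal.ofReal (1 + κ w)) :=
    (h.ker.meas.const_add 1).ennreal_ofReal
  unfold piM dens
  have h1 : ∀ i, mix (t i) P = (mix (t i) l).withDensity (fun w => ENNReal.ofReal (1 + κ w)) :=
    fun i => (h.mix (t i)).dens
  have : ∀ i, SigmaFinite ((mix (t i) l).withDensity (fun w => ENNReal.ofReal (1 + κ w))) := by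
    intro i; rw [← h1]; infer_instance
  simp only [h1]
  rw [pi_withDensity _ _ hm]
  congr 1
  funext w
  rw [ENNReal.ofReal_prod_of_nonneg]
  exact fun i _ => h.ker.nonneg (w i)

lemma integral_piM {κ : ℝ → ℝ} {l P : Measure ℝ} [IsProbabilityMeasure l] [IsProbabilityMeasure P]
    (h : BMS κ l P) (t : ι → unitInterval) (g : (ι → ℝ) → ℝ) :
    ∫ w, g w ∂(piM t P) = ∫ w, dens κ w * g w ∂(piM t l) := by
  rw [piM_dens h t, integral_withDensity_eq_integral_toReal_smul
    (measurable_dens h.ker).ennreal_ofReal (Filter.Eventually.of_forall fun _ => ENNReal.ofReal_lt_top)]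
  refine integral_congr_ae (Filter.Eventually.of_forall fun w => ?_)
  simp only [smul_eq_mul]
  rw [ENNReal.toReal_ofReal (dens_nonneg h.ker w)]

lemma integrable_piM {κ : ℝ → ℝ} {l P : Measure ℝ} [IsProbabilityMeasure l] [IsProbabilityMeasure P]
    (h : BMS κ l P) (t : ι → unitInterval) (g : (ι → ℝ) → ℝ) :
    Integrable g (piM t P) ↔ Integrable (fun w => dens κ w * g w) (piM t l) := by
  rw [piM_dens h t, integrable_withDensity_iff_integrable_smul₀'
    (measurable_dens h.ker).ennreal_ofReal.aemeasurable
    (Filter.Eventually.of_forall fun _ => ENNReal.ofReal_lt_top)]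
  refine integrable_congr (Filter.Eventually.of_forall fun w => ?_)
  simp only [smul_eq_mul]
  rw [ENNReal.toReal_ofReal (dens_nonneg h.ker w)]

/-- sign vectors -/
def IsSign (x : ι → ℝ) : Prop := ∀ i, x i = 1 ∨ x i = -1

lemma flip_preserve {l : Measure ℝ} [IsProbabilityMeasure l] (h : l.map Neg.neg = l)
    (t : ι → unitInterval) {x : ι → ℝ} (hx : IsSign x) :
    MeasurePreserving (fun w : ι → ℝ => fun i => x i * w i) (piM t l) (piM t l) := by
  refine measurePreserving_pi _ _ fun i => ?_
  have hs : (mix (t i) l).map Neg.neg = mix (t i) l := by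
    unfold RMP.mix
    rw [Measure.map_add _ _ measurable_neg, Measure.map_smul, Measure.map_smul, h,
      Measure.map_dirac' (f := Neg.neg) measurable_neg (0:ℝ)]
    simp
  rcases hx i with h1 | h1
  · have e : (fun y : ℝ => x i * y) = id := by funext y; simp [h1]
    rw [show HMul.hMul (x i) = id from e]; exact MeasurePreserving.id _
  · have e : (fun y : ℝ => x i * y) = Neg.neg := by funext y; simp [h1]
    rw [show HMul.hMul (x i) = Neg.neg from e]; exact ⟨measurable_neg, hs⟩

/-- erase coordinates outside `S` -/
def mask (S : Finset ι) (w : ι → ℝ) : ι → ℝ := fun i => if i ∈ S then w i else 0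

lemma measurable_mask (S : Finset ι) : Measurable (mask S : (ι → ℝ) → ι → ℝ) := by
  refine measurable_pi_lambda _ fun i => ?_
  unfold mask
  by_cases h : i ∈ S
  · simp only [h, if_true]; exact measurable_pi_apply i
  · simp only [h, if_false]; exact measurable_const

/-- probability of the erasure pattern -/
def pw (t : ι → ℝ) (S : Finset ι) : ℝ := (∏ i ∈ S, t i) * ∏ i ∈ Sᶜ, (1 - t i)

lemma pw_nonneg (t : ι → unitInterval) (S : Finset ι) : 0 ≤ pw (fun i => (t i : ℝ)) S :=
  mul_nonneg (Finset.prod_nonneg fun i _ => (t i).2.1)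
    (Finset.prod_nonneg fun i _ => by linarith [(t i).2.2])

lemma sum_pw (t : ι → ℝ) : ∑ S, pw t S = 1 := by
  unfold pw
  rw [← Fintype.prod_add]; simp

lemma piM_expand (t : ι → unitInterval) (μ : Measure ℝ) [IsProbabilityMeasure μ] :
    piM t μ = ∑ S : Finset ι, ENNReal.ofReal (pw (fun i => (t i : ℝ)) S) •
      (Measure.pi (fun _ : ι => μ)).map (mask S) := by
  unfold piM
  refine Measure.pi_eq ?_
  intro s hs
  have e : ∀ i, mix (t i) μ (s i)
      = ENNReal.ofReal (t i) * μ (s i) + ENNReal.ofReal (1 - t i) * Measure.dirac 0 (s i) := by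
    intro i; simp [mix]
  simp only [e]
  rw [Fintype.prod_add, Measure.finsetSum_apply]
  refine Finset.sum_congr rfl fun S _ => ?_
  rw [Measure.smul_apply, Measure.map_apply (measurable_mask S) (MeasurableSet.univ_pi hs)]
  classical
  have hpre : mask S ⁻¹' (Set.pi Set.univ s)
      = Set.pi Set.univ (fun i => if i ∈ S then s i else {_w : ℝ | (0:ℝ) ∈ s i}) := by
    ext w
    simp only [Set.mem_preimage, Set.mem_pi, Set.mem_univ, forall_true_left, mask]
    refine forall_congr' fun i => ?_
    by_cases h : i ∈ S <;> simp [h]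
  rw [hpre, Measure.pi_pi, smul_eq_mul, pw, ENNReal.ofReal_mul
    (Finset.prod_nonneg fun i _ => (t i).2.1), ENNReal.ofReal_prod_of_nonneg (fun i _ => (t i).2.1),
    ENNReal.ofReal_prod_of_nonneg (fun i _ => by linarith [(t i).2.2]),
    ← Finset.prod_mul_prod_compl S, Finset.prod_mul_distrib, Finset.prod_mul_distrib]
  have h1 : ∏ i ∈ S, μ (if i ∈ S then s i else {_w : ℝ | (0:ℝ) ∈ s i}) = ∏ i ∈ S, μ (s i) :=
    Finset.prod_congr rfl fun i hi => by simp [hi]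
  have h2 : ∏ i ∈ Sᶜ, μ (if i ∈ S then s i else {_w : ℝ | (0:ℝ) ∈ s i})
      = ∏ i ∈ Sᶜ, Measure.dirac (0:ℝ) (s i) := by
    refine Finset.prod_congr rfl fun i hi => ?_
    rw [Finset.mem_compl] at hi
    rw [if_neg hi, Measure.dirac_apply' _ (hs i)]
    by_cases h0 : (0:ℝ) ∈ s i <;> simp [h0]
  rw [h1, h2]
  ring

lemma integral_expand (t : ι → unitInterval) (μ : Measure ℝ) [IsProbabilityMeasure μ]
    (g : (ι → ℝ) → ℝ) (hg : Measurable g) (c : ℝ) (hc : ∀ w, |g w| ≤ c) :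
    ∫ w, g w ∂(piM t μ) = ∑ S : Finset ι, pw (fun i => (t i : ℝ)) S *
      ∫ w, g (mask S w) ∂(Measure.pi (fun _ : ι => μ)) := by
  rw [piM_expand t μ, integral_finsetSum_measure]
  · refine Finset.sum_congr rfl fun S _ => ?_
    rw [integral_smul_measure, ENNReal.toReal_ofReal (pw_nonneg t S), smul_eq_mul,
      integral_map (measurable_mask S).aemeasurable hg.aestronglyMeasurable]
  · intro S _
    have : IsProbabilityMeasure ((Measure.pi (fun _ : ι => μ)).map (mask S)) :=
      Measure.isProbabilityMeasure_map (measurable_mask S).aemeasurable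
    refine Integrable.smul_measure ?_ ENNReal.ofReal_ne_top
    exact Integrable.of_bound hg.aestronglyMeasurable c (Filter.Eventually.of_forall hc)

lemma pi_update (l : ι → Measure ℝ) [∀ i, IsProbabilityMeasure (l i)] (j : ι) (μ : Measure ℝ)
    [IsProbabilityMeasure μ] :
    MeasurePreserving (fun q : (ι → ℝ) × ℝ => Function.update q.1 j q.2) ((Measure.pi l).prod μ)
      (Measure.pi (Function.update l j μ)) := by
  have hm : Measurable (fun q : (ι → ℝ) × ℝ => Function.update q.1 j q.2) := by
    refine measurable_pi_lambda _ fun i => ?_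
    by_cases h : i = j
    · subst h; simpa using measurable_snd
    · simp only [Function.update_of_ne h]
      exact (measurable_pi_apply i).comp measurable_fst
  refine ⟨hm, ?_⟩
  have : ∀ i, IsProbabilityMeasure (Function.update l j μ i) := by
    intro i
    by_cases h : i = j
    · subst h; simpa
    · rw [Function.update_of_ne h]; infer_instance
  symm
  refine Measure.pi_eq ?_
  intro s hs
  rw [Measure.map_apply hm (MeasurableSet.univ_pi hs)]
  have hpre : (fun q : (ι → ℝ) × ℝ => Function.update q.1 j q.2) ⁻¹' (Set.pi Set.univ s)
      = (Set.pi Set.univ (Function.update s j Set.univ)) ×ˢ s j := by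
    ext ⟨w, a⟩
    simp only [Set.mem_preimage, Set.mem_pi, Set.mem_univ, forall_true_left, Set.mem_prod]
    constructor
    · intro h
      refine ⟨fun i => ?_, by simpa using h j⟩
      by_cases e : i = j
      · subst e; simp
      · have := h i
        rw [Function.update_of_ne e] at this ⊢; exact this
    · rintro ⟨h1, h2⟩ i
      by_cases e : i = j
      · subst e; simpa
      · have := h1 i
        rw [Function.update_of_ne e] at this ⊢; exact this
  rw [hpre, Measure.prod_prod, Measure.pi_pi, ← Finset.mul_prod_erase _ _ (Finset.mem_univ j),
    ← Finset.mul_prod_erase (Finset.univ) (fun i => Function.update l j μ i (s i)) (Finset.mem_univ j)]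
  simp only [Function.update_self, measure_univ, one_mul]
  rw [mul_comm]
  congr 1
  refine Finset.prod_congr rfl fun i hi => ?_
  have e := Finset.ne_of_mem_erase hi
  rw [Function.update_of_ne e, Function.update_of_ne e]

lemma piM_update (t : ι → unitInterval) (j : ι) (μ : Measure ℝ) [IsProbabilityMeasure μ] :
    MeasurePreserving (fun q : (ι → ℝ) × ℝ => Function.update q.1 j q.2)
      ((piM (Function.update t j 0) μ).prod μ) (piM (Function.update t j 1) μ) := by
  have := pi_update (fun i => mix (Function.update t j 0 i) μ) j μ
  unfold piM
  convert this using 2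
  funext i
  by_cases e : i = j
  · subst e; simp [mix_one]
  · simp [Function.update_of_ne e]

lemma piM_zero_ae (t : ι → unitInterval) (j : ι) (ht : t j = 0) (μ : Measure ℝ)
    [IsProbabilityMeasure μ] : ∀ᵐ w ∂(piM t μ), w j = 0 := by
  have h : ∀ᵐ s ∂(mix (t j) μ), s = 0 := by
    rw [ht, mix_zero]
    exact (ae_dirac_iff (p := fun s : ℝ => s = 0) (measurableSet_singleton (0:ℝ))).2 rfl
  exact (measurePreserving_eval (fun i => mix (t i) μ) j).quasiMeasurePreserving.ae h

lemma integrable_bdd {α : Type*} [MeasurableSpace α] {μ : Measure α} [IsProbabilityMeasure μ]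
    {g : α → ℝ} (hg : Measurable g) (c : ℝ) (hc : ∀ w, |g w| ≤ c) : Integrable g μ :=
  Integrable.of_bound hg.aestronglyMeasurable c (Filter.Eventually.of_forall hc)

end
end RMP

open MeasureTheory ProbabilityTheory
set_option linter.unusedSectionVars false
set_option linter.unusedVariables false
namespace RMP
noncomputable section
variable {ι : Type*} [Fintype ι] [DecidableEq ι]

/-- finite group of sign vectors -/
structure IsCode (C : Finset (ι → ℝ)) : Prop where
  sign : ∀ x ∈ C, IsSign x
  one : (1 : ι → ℝ) ∈ C
  mul : ∀ x ∈ C, ∀ y ∈ C, x * y ∈ C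

lemma IsSign.sq {x : ι → ℝ} (h : IsSign x) (i : ι) : x i * x i = 1 := by
  rcases h i with h | h <;> rw [h] <;> norm_num

lemma IsSign.abs {x : ι → ℝ} (h : IsSign x) (i : ι) : |x i| = 1 := by
  rcases h i with h | h <;> rw [h] <;> norm_num

lemma IsSign.mul_self {x : ι → ℝ} (h : IsSign x) : x * x = 1 := by
  funext i; exact h.sq i

lemma IsCode.card_pos {C : Finset (ι → ℝ)} (h : IsCode C) : (0:ℝ) < C.card := by
  exact_mod_cast Finset.card_pos.2 ⟨1, h.one⟩

lemma Ker.sign {κ : ℝ → ℝ} (h : Ker κ) {x : ι → ℝ} (hx : IsSign x) (w : ι → ℝ) (i : ι) :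
    κ ((x * w) i) = x i * κ (w i) := by
  rw [Pi.mul_apply]
  rcases hx i with e | e <;> rw [e] <;> simp [h.odd]

/-- output density of the code -/
def pc (κ : ℝ → ℝ) (C : Finset (ι → ℝ)) (w : ι → ℝ) : ℝ :=
  (∑ x ∈ C, ∏ i, (1 + x i * κ (w i))) / C.card
/-- numerator of the MAP estimator -/
def nc (κ : ℝ → ℝ) (C : Finset (ι → ℝ)) (o : ι) (w : ι → ℝ) : ℝ :=
  (∑ x ∈ C, x o * ∏ i, (1 + x i * κ (w i))) / C.card
/-- estimator -/
def Wc (κ : ℝ → ℝ) (C : Finset (ι → ℝ)) (o : ι) (w : ι → ℝ) : ℝ := nc κ C o w / pc κ C w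

lemma term_nonneg {κ : ℝ → ℝ} (h : Ker κ) {x : ι → ℝ} (hx : IsSign x) (w : ι → ℝ) :
    0 ≤ ∏ i, (1 + x i * κ (w i)) := by
  refine Finset.prod_nonneg fun i _ => ?_
  have := abs_le.1 (h.bd (w i))
  rcases hx i with e | e <;> rw [e] <;> linarith [this.1, this.2]

lemma term_le {κ : ℝ → ℝ} (h : Ker κ) {x : ι → ℝ} (hx : IsSign x) (w : ι → ℝ) :
    ∏ i, (1 + x i * κ (w i)) ≤ 2 ^ (Fintype.card ι) := by
  rw [← Finset.card_univ, ← Finset.prod_const]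
  refine Finset.prod_le_prod (fun i _ => ?_) (fun i _ => ?_)
  all_goals
    have := abs_le.1 (h.bd (w i))
    rcases hx i with e | e <;> rw [e] <;> linarith [this.1, this.2]

lemma term_eq {κ : ℝ → ℝ} (h : Ker κ) {x : ι → ℝ} (hx : IsSign x) (w : ι → ℝ) :
    ∏ i, (1 + x i * κ (w i)) = dens κ (x * w) := by
  unfold dens
  exact Finset.prod_congr rfl fun i _ => by rw [h.sign hx]

section
variable {κ : ℝ → ℝ} {C : Finset (ι → ℝ)}

lemma pc_nonneg (h : Ker κ) (hC : IsCode C) (w : ι → ℝ) : 0 ≤ pc κ C w :=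
  div_nonneg (Finset.sum_nonneg fun x hx => term_nonneg h (hC.sign x hx) w) hC.card_pos.le

lemma pc_le (h : Ker κ) (hC : IsCode C) (w : ι → ℝ) : pc κ C w ≤ 2 ^ (Fintype.card ι) := by
  unfold pc
  rw [div_le_iff₀ hC.card_pos]
  refine (Finset.sum_le_sum fun x hx => term_le h (hC.sign x hx) w).trans ?_
  simp [mul_comm]

lemma abs_nc_le (h : Ker κ) (hC : IsCode C) (o : ι) (w : ι → ℝ) : |nc κ C o w| ≤ pc κ C w := by
  unfold nc pc
  rw [abs_div, abs_of_pos hC.card_pos]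
  refine div_le_div_of_nonneg_right ?_ hC.card_pos.le
  refine (Finset.abs_sum_le_sum_abs _ _).trans (Finset.sum_le_sum fun x hx => ?_)
  rw [abs_mul, (hC.sign x hx).abs, one_mul, abs_of_nonneg (term_nonneg h (hC.sign x hx) w)]

lemma abs_Wc_le (h : Ker κ) (hC : IsCode C) (o : ι) (w : ι → ℝ) : |Wc κ C o w| ≤ 1 := by
  unfold Wc
  rw [abs_div, abs_of_nonneg (pc_nonneg h hC w)]
  exact div_le_one_of_le₀ (abs_nc_le h hC o w) (pc_nonneg h hC w)

lemma pc_mul_Wc (h : Ker κ) (hC : IsCode C) (o : ι) (w : ι → ℝ) :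
    pc κ C w * Wc κ C o w = nc κ C o w := by
  unfold Wc
  by_cases h0 : pc κ C w = 0
  · have := abs_nc_le h hC o w
    rw [h0] at this
    rw [abs_nonpos_iff.1 this]; simp
  · field_simp

lemma measurable_term (h : Ker κ) (x : ι → ℝ) :
    Measurable fun w : ι → ℝ => ∏ i, (1 + x i * κ (w i)) :=
  Finset.measurable_prod _ fun i _ =>
    ((h.meas.comp (measurable_pi_apply i)).const_mul (x i)).const_add 1

lemma measurable_pc (h : Ker κ) (C : Finset (ι → ℝ)) : Measurable (pc κ C) :=
  (Finset.measurable_sum _ fun x _ => measurable_term h x).div_const _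

lemma measurable_nc (h : Ker κ) (C : Finset (ι → ℝ)) (o : ι) : Measurable (nc κ C o) :=
  (Finset.measurable_sum _ fun x _ => (measurable_term h x).const_mul _).div_const _

lemma measurable_Wc (h : Ker κ) (C : Finset (ι → ℝ)) (o : ι) : Measurable (Wc κ C o) :=
  (measurable_nc h C o).div (measurable_pc h C)

lemma sum_shift (hC : IsCode C) {x : ι → ℝ} (hx : x ∈ C) (F : (ι → ℝ) → ℝ) :
    ∑ y ∈ C, F (y * x) = ∑ y ∈ C, F y := by
  refine Finset.sum_bij' (fun y _ => y * x) (fun y _ => y * x) ?_ ?_ ?_ ?_ ?_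
  · exact fun y hy => hC.mul y hy x hx
  · exact fun y hy => hC.mul y hy x hx
  · intro y _; rw [mul_assoc, (hC.sign x hx).mul_self, mul_one]
  · intro y _; rw [mul_assoc, (hC.sign x hx).mul_self, mul_one]
  · exact fun y _ => rfl

lemma pc_flip (h : Ker κ) (hC : IsCode C) {x : ι → ℝ} (hx : x ∈ C) (w : ι → ℝ) :
    pc κ C (x * w) = pc κ C w := by
  unfold pc
  congr 1
  rw [← sum_shift hC hx (fun y => ∏ i, (1 + y i * κ (w i)))]
  refine Finset.sum_congr rfl fun y _ => Finset.prod_congr rfl fun i _ => ?_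
  rw [h.sign (hC.sign x hx), Pi.mul_apply]; ring

lemma nc_flip (h : Ker κ) (hC : IsCode C) (o : ι) {x : ι → ℝ} (hx : x ∈ C) (w : ι → ℝ) :
    nc κ C o (x * w) = x o * nc κ C o w := by
  unfold nc
  rw [← mul_div_assoc]
  congr 1
  rw [← sum_shift hC hx (fun y => y o * ∏ i, (1 + y i * κ (w i))), Finset.mul_sum]
  refine Finset.sum_congr rfl fun y _ => ?_
  have : ∏ i, (1 + y i * κ ((x * w) i)) = ∏ i, (1 + (y * x) i * κ (w i)) :=
    Finset.prod_congr rfl fun i _ => by rw [h.sign (hC.sign x hx), Pi.mul_apply]; ring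
  rw [this, Pi.mul_apply]
  linear_combination (-(y o) * ∏ i, (1 + (y * x) i * κ (w i))) * (hC.sign x hx).sq o

lemma Wc_flip (h : Ker κ) (hC : IsCode C) (o : ι) {x : ι → ℝ} (hx : x ∈ C) (w : ι → ℝ) :
    Wc κ C o (x * w) = x o * Wc κ C o w := by
  unfold Wc
  rw [pc_flip h hC hx, nc_flip h hC o hx, mul_div_assoc]

lemma mp_integral {α β : Type*} [MeasurableSpace α] [MeasurableSpace β] {μ : Measure α}
    {ν : Measure β} {T : α → β} (hT : MeasurePreserving T μ ν) {g : β → ℝ} (hg : Measurable g) :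
    ∫ a, g (T a) ∂μ = ∫ b, g b ∂ν := by
  rw [← hT.map_eq, integral_map hT.measurable.aemeasurable hg.aestronglyMeasurable]

variable {l P : Measure ℝ} [IsProbabilityMeasure l] [IsProbabilityMeasure P]

lemma nish_gen (h : BMS κ l P) (hC : IsCode C) (t : ι → unitInterval) (χ : (ι → ℝ) → ℝ)
    (_hχ : ∀ x ∈ C, χ x * χ x = 1) (g : (ι → ℝ) → ℝ) (hg : Measurable g)
    (hgi : Integrable g (piM t P)) (hgC : ∀ x ∈ C, ∀ w, g (x * w) = χ x * g w) :
    ∫ w, (∑ x ∈ C, χ x * ∏ i, (1 + x i * κ (w i))) / C.card * g w ∂(piM t l)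
      = ∫ w, g w ∂(piM t P) := by
  have hgi' := (integrable_piM h t g).1 hgi
  have hmeas : Measurable fun w : ι → ℝ => dens κ w * g w := (measurable_dens h.ker).mul hg
  have e : ∀ w : ι → ℝ, (∑ x ∈ C, χ x * ∏ i, (1 + x i * κ (w i))) / C.card * g w
      = (∑ x ∈ C, dens κ (x * w) * g (x * w)) / C.card := by
    intro w
    rw [div_mul_eq_mul_div, Finset.sum_mul]
    congr 1
    refine Finset.sum_congr rfl fun x hx => ?_
    rw [hgC x hx, term_eq h.ker (hC.sign x hx)]; ring
  simp only [e]
  rw [integral_div, integral_finsetSum]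
  · have : ∀ x ∈ C, ∫ w, dens κ (x * w) * g (x * w) ∂(piM t l) = ∫ w, g w ∂(piM t P) := by
      intro x hx
      rw [integral_piM h t g]
      exact mp_integral (flip_preserve h.symm t (hC.sign x hx)) hmeas
    rw [Finset.sum_congr rfl this]
    rw [Finset.sum_const, nsmul_eq_mul]
    have := hC.card_pos.ne'
    field_simp
  · intro x hx
    exact (flip_preserve h.symm t (hC.sign x hx)).integrable_comp_of_integrable hgi'

lemma N0 (h : BMS κ l P) (hC : IsCode C) (t : ι → unitInterval)
    (g : (ι → ℝ) → ℝ) (hg : Measurable g)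
    (hgi : Integrable g (piM t P)) (hgC : ∀ x ∈ C, ∀ w, g (x * w) = g w) :
    ∫ w, pc κ C w * g w ∂(piM t l) = ∫ w, g w ∂(piM t P) := by
  have := nish_gen h hC t (fun _ => 1) (by simp) g hg hgi (by simpa using hgC)
  simpa [pc] using this

/-- Nishimori identity -/
lemma nish (h : BMS κ l P) (hC : IsCode C) (t : ι → unitInterval) (o : ι)
    (g : (ι → ℝ) → ℝ) (hg : Measurable g) (c : ℝ) (hgc : ∀ w, |g w| ≤ c)
    (hgC : ∀ x ∈ C, ∀ w, g (x * w) = x o * g w) :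
    ∫ w, Wc κ C o w * g w ∂(piM t P) = ∫ w, g w ∂(piM t P) := by
  have hm := measurable_Wc h.ker C o
  rw [← nish_gen h hC t (fun x => x o) (fun x hx => (hC.sign x hx).sq o) g hg
    (integrable_bdd hg c hgc) hgC, ← N0 h hC t (fun w => Wc κ C o w * g w) (hm.mul hg)]
  · refine integral_congr_ae (Filter.Eventually.of_forall fun w => ?_)
    simp only
    rw [← mul_assoc, pc_mul_Wc h.ker hC]; rfl
  · refine integrable_bdd (hm.mul hg) c fun w => ?_
    rw [abs_mul]
    calc _ ≤ 1 * |g w| := mul_le_mul_of_nonneg_right (abs_Wc_le h.ker hC o w) (abs_nonneg _)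
      _ ≤ c := by rw [one_mul]; exact hgc w
  · intro x hx w
    rw [Wc_flip h.ker hC o hx, hgC x hx]
    linear_combination (Wc κ C o w * g w) * (hC.sign x hx).sq o

lemma sq_le_one_of_abs {x : ℝ} (h : |x| ≤ 1) : |x ^ 2| ≤ 1 := by
  rw [abs_pow]; exact pow_le_one₀ (abs_nonneg _) h

/-- for nested codes -/
lemma nish_sub (h : BMS κ l P) (hC : IsCode C) {C' : Finset (ι → ℝ)} (hC' : IsCode C') (hs : C ⊆ C')
    (t : ι → unitInterval) (o : ι) :
    ∫ w, Wc κ C o w * Wc κ C' o w ∂(piM t P) = ∫ w, Wc κ C' o w ∂(piM t P) :=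
  nish h hC t o _ (measurable_Wc h.ker C' o) 1 (abs_Wc_le h.ker hC' o)
    fun x hx w => Wc_flip h.ker hC' o (hs hx) w

/-- overlap -/
def alpha (κ : ℝ → ℝ) (C : Finset (ι → ℝ)) (o : ι) (μ : Measure (ι → ℝ)) : ℝ :=
  ∫ w, (Wc κ C o w) ^ 2 ∂μ

lemma alpha_eq (h : BMS κ l P) (hC : IsCode C) (t : ι → unitInterval) (o : ι) :
    alpha κ C o (piM t P) = ∫ w, Wc κ C o w ∂(piM t P) := by
  rw [← nish_sub h hC hC subset_rfl t o]; unfold alpha; simp only [sq]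

lemma alpha_nonneg (o : ι) (μ : Measure (ι → ℝ)) : 0 ≤ alpha κ C o μ :=
  integral_nonneg fun w => sq_nonneg _

lemma integrable_sqW (h : Ker κ) (hC : IsCode C) (o : ι) (μ : Measure (ι → ℝ))
    [IsProbabilityMeasure μ] : Integrable (fun w => (Wc κ C o w)^2) μ :=
  integrable_bdd ((measurable_Wc h C o).pow_const 2) 1 fun w => sq_le_one_of_abs (abs_Wc_le h hC o w)

lemma integrable_W (h : Ker κ) (hC : IsCode C) (o : ι) (μ : Measure (ι → ℝ))
    [IsProbabilityMeasure μ] : Integrable (fun w => (Wc κ C o w)) μ :=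
  integrable_bdd (measurable_Wc h C o) 1 fun w => (abs_Wc_le h hC o w)

lemma integrable_WW (h : Ker κ) (hC : IsCode C) {C' : Finset (ι → ℝ)} (hC' : IsCode C') (o : ι)
    (μ : Measure (ι → ℝ))
    [IsProbabilityMeasure μ] : Integrable (fun w => Wc κ C o w * Wc κ C' o w) μ :=
  integrable_bdd ((measurable_Wc h C o).mul (measurable_Wc h C' o)) 1 fun w => by
    rw [abs_mul]
    exact mul_le_one₀ (abs_Wc_le h hC o w) (abs_nonneg _) (abs_Wc_le h hC' o w)

lemma alpha_le_one (h : Ker κ) (hC : IsCode C) (o : ι) (μ : Measure (ι → ℝ))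
    [IsProbabilityMeasure μ] : alpha κ C o μ ≤ 1 := by
  have : alpha κ C o μ ≤ ∫ _w, (1:ℝ) ∂μ :=
    integral_mono (integrable_sqW h hC o μ) (integrable_const _)
      fun w => (abs_le.1 (sq_le_one_of_abs (abs_Wc_le h hC o w))).2
  simpa using this

end
end
end RMP

open MeasureTheory ProbabilityTheory
set_option linter.unusedSectionVars false
set_option linter.unusedVariables false
namespace RMP
noncomputable section
variable {ι : Type*} [Fintype ι] [DecidableEq ι]

/-- bounded measurable functions -/
def Bd {α : Type*} [MeasurableSpace α] (g : α → ℝ) : Prop := Measurable g ∧ ∃ c, ∀ w, |g w| ≤ c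

section bd
variable {α β : Type*} [MeasurableSpace α] [MeasurableSpace β] {g f : α → ℝ}

lemma Bd.int (hg : Bd g) (μ : Measure α) [IsProbabilityMeasure μ] : Integrable g μ := by
  obtain ⟨c, hc⟩ := hg.2
  exact integrable_bdd hg.1 c hc

lemma Bd.mul (hg : Bd g) (hf : Bd f) : Bd (fun w => g w * f w) := by
  obtain ⟨c, hc⟩ := hg.2
  obtain ⟨d, hd⟩ := hf.2
  refine ⟨hg.1.mul hf.1, c * d, fun w => ?_⟩
  rw [abs_mul]
  exact mul_le_mul (hc w) (hd w) (abs_nonneg _) ((abs_nonneg _).trans (hc w))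

lemma Bd.add (hg : Bd g) (hf : Bd f) : Bd (fun w => g w + f w) := by
  obtain ⟨c, hc⟩ := hg.2
  obtain ⟨d, hd⟩ := hf.2
  exact ⟨hg.1.add hf.1, c + d, fun w => (abs_add_le _ _).trans (add_le_add (hc w) (hd w))⟩

lemma Bd.const_mul (hg : Bd g) (a : ℝ) : Bd (fun w => a * g w) := by
  obtain ⟨c, hc⟩ := hg.2
  refine ⟨hg.1.const_mul a, |a| * c, fun w => ?_⟩
  rw [abs_mul]
  exact mul_le_mul_of_nonneg_left (hc w) (abs_nonneg _)

lemma Bd.sub (hg : Bd g) (hf : Bd f) : Bd (fun w => g w - f w) := by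
  have := hg.add (hf.const_mul (-1))
  simpa [sub_eq_add_neg] using this

lemma Bd.comp (hg : Bd g) {T : β → α} (hT : Measurable T) : Bd (fun w => g (T w)) := by
  obtain ⟨c, hc⟩ := hg.2
  exact ⟨hg.1.comp hT, c, fun w => hc _⟩
end bd

/-- the coordinate-mixing map -/
def mixmap (S : Finset ι) (q : (ι → ℝ) × (ι → ℝ)) : ι → ℝ := fun i => if i ∈ S then q.1 i else q.2 i

lemma measurable_mixmap (S : Finset ι) :
    Measurable (mixmap S : (ι → ℝ) × (ι → ℝ) → ι → ℝ) := by
  refine measurable_pi_lambda _ fun i => ?_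
  unfold mixmap
  by_cases h : i ∈ S
  · simp only [h, if_true]; exact (measurable_pi_apply i).comp measurable_fst
  · simp only [h, if_false]; exact (measurable_pi_apply i).comp measurable_snd

variable (μ : ι → Measure ℝ) [∀ i, IsProbabilityMeasure (μ i)]

lemma mp_swapmap (S : Finset ι) :
    MeasurePreserving (fun q : (ι → ℝ) × (ι → ℝ) => (mixmap S q, mixmap S q.swap))
      ((Measure.pi μ).prod (Measure.pi μ)) ((Measure.pi μ).prod (Measure.pi μ)) := by
  have h1 := measurePreserving_arrowProdEquivProdArrow ℝ ℝ ι μ μ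
  have h2 : MeasurePreserving (fun (x : ι → ℝ × ℝ) i => (if i ∈ S then id else Prod.swap) (x i))
      (Measure.pi fun i => (μ i).prod (μ i)) (Measure.pi fun i => (μ i).prod (μ i)) := by
    refine measurePreserving_pi _ _ fun i => ?_
    by_cases h : i ∈ S
    · simp only [h, if_true]; exact MeasurePreserving.id _
    · simp only [h, if_false]; exact Measure.measurePreserving_swap
  have h3 := (h1.comp h2).comp h1.symm
  convert h3 using 1
  funext q
  refine Prod.ext ?_ ?_ <;> funext i <;> by_cases h : i ∈ S <;>
    simp [mixmap, h, MeasurableEquiv.arrowProdEquivProdArrow, Equiv.arrowProdEquivProdArrow]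

lemma mp_mixmap (S : Finset ι) :
    MeasurePreserving (mixmap S) ((Measure.pi μ).prod (Measure.pi μ)) (Measure.pi μ) :=
  measurePreserving_fst.comp (mp_swapmap μ S)

/-- averaging out the coordinates outside `S` -/
def KK (S : Finset ι) (g : (ι → ℝ) → ℝ) (w : ι → ℝ) : ℝ := ∫ w', g (mixmap S (w, w')) ∂(Measure.pi μ)

variable {g f : (ι → ℝ) → ℝ}

lemma bd_KK (S : Finset ι) (hg : Bd g) : Bd (KK μ S g) := by
  have h := hg.comp (measurable_mixmap (ι := ι) S)
  obtain ⟨c, hc⟩ := hg.2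
  refine ⟨?_, c, fun w => ?_⟩
  · exact (h.1.stronglyMeasurable.integral_prod_right').measurable
  · have := norm_integral_le_of_norm_le_const (μ := Measure.pi μ)
      (f := fun w' => g (mixmap S (w, w'))) (C := c) (Filter.Eventually.of_forall fun w' => hc _)
    unfold KK; simpa using this

lemma int_KK_mul (S : Finset ι) (hg : Bd g) (hf : Bd f) :
    ∫ w, KK μ S g w * f w ∂(Measure.pi μ)
      = ∫ q, g (mixmap S q) * f q.1 ∂((Measure.pi μ).prod (Measure.pi μ)) := by
  have hb : Bd (fun q : (ι → ℝ) × (ι → ℝ) => g (mixmap S q) * f q.1) :=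
    (hg.comp (measurable_mixmap S)).mul (hf.comp measurable_fst)
  rw [integral_prod _ (hb.int _)]
  refine integral_congr_ae (Filter.Eventually.of_forall fun w => ?_)
  simp only [KK]
  rw [integral_mul_const]

lemma KK_adj (S : Finset ι) (hg : Bd g) (hf : Bd f) :
    ∫ w, KK μ S g w * f w ∂(Measure.pi μ) = ∫ w, KK μ S f w * g w ∂(Measure.pi μ) := by
  rw [int_KK_mul μ S hg hf, int_KK_mul μ S hf hg]
  have hb : Bd (fun q : (ι → ℝ) × (ι → ℝ) => f (mixmap S q) * g q.1) :=
    (hf.comp (measurable_mixmap S)).mul (hg.comp measurable_fst)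
  rw [← mp_integral (mp_swapmap μ S) hb.1]
  refine integral_congr_ae (Filter.Eventually.of_forall fun q => ?_)
  have : mixmap S (mixmap S q, mixmap S q.swap) = q.1 := by
    funext i; by_cases h : i ∈ S <;> simp [mixmap, h]
  simp only [this]; ring

lemma KK_comp (S T : Finset ι) (hg : Bd g) : KK μ S (KK μ T g) = KK μ (S ∩ T) g := by
  funext w
  have hm : Measurable fun q : (ι → ℝ) × (ι → ℝ) => mixmap (S ∩ T) (w, mixmap T q) :=
    (measurable_mixmap (S ∩ T)).comp (measurable_const.prodMk (measurable_mixmap T))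
  have hm2 : Measurable fun q : (ι → ℝ) => mixmap (S ∩ T) (w, q) :=
    (measurable_mixmap (S ∩ T)).comp (measurable_const.prodMk measurable_id)
  have h1 := mp_integral (mp_mixmap μ T) (hg.comp hm2).1
  unfold KK
  rw [← h1, integral_prod _ ((hg.comp hm).int _)]
  refine integral_congr_ae (Filter.Eventually.of_forall fun w' => ?_)
  refine integral_congr_ae (Filter.Eventually.of_forall fun w'' => ?_)
  simp only
  congr 1
  funext i; by_cases h : i ∈ S <;> by_cases h' : i ∈ T <;> simp [mixmap, h, h']

lemma KK_inner (S T : Finset ι) (hg : Bd g) (hf : Bd f) :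
    ∫ w, KK μ S g w * KK μ T f w ∂(Measure.pi μ) = ∫ w, KK μ (S ∩ T) f w * g w ∂(Measure.pi μ) := by
  rw [KK_adj μ S hg (bd_KK μ T hf), KK_comp μ S T hf]

/-- energy -/
def en (g : (ι → ℝ) → ℝ) (S : Finset ι) : ℝ := ∫ w, KK μ S g w * g w ∂(Measure.pi μ)

lemma en_inner (S T : Finset ι) (hg : Bd g) :
    ∫ w, KK μ S g w * KK μ T g w ∂(Measure.pi μ) = en μ g (S ∩ T) := KK_inner μ S T hg hg

lemma en_univ (g : (ι → ℝ) → ℝ) : en μ g Finset.univ = ∫ w, (g w)^2 ∂(Measure.pi μ) := by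
  unfold en
  refine integral_congr_ae (Filter.Eventually.of_forall fun w => ?_)
  have : ∀ w', mixmap Finset.univ (w, w') = w := fun w' => by funext i; simp [mixmap]
  simp [KK, this, sq]

lemma en_empty (g : (ι → ℝ) → ℝ) : en μ g ∅ = (∫ w, g w ∂(Measure.pi μ))^2 := by
  unfold en
  have : ∀ w w' : ι → ℝ, mixmap ∅ (w, w') = w' := fun w w' => by funext i; simp [mixmap]
  simp only [KK, this]
  rw [integral_const_mul, sq]

lemma en_supermod (hg : Bd g) {D T : Finset ι} {j : ι} (hDT : D ⊆ T) (hj : j ∉ T) :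
    en μ g (insert j D) - en μ g D ≤ en μ g (insert j T) - en μ g T := by
  have hjD : j ∉ D := fun h => hj (hDT h)
  have b := fun S => bd_KK μ S hg
  have I := fun S T => en_inner μ S T hg
  have J := fun S T => ((b S).mul (b T)).int (Measure.pi μ)
  have h0 : 0 ≤ ∫ w, (KK μ (insert j T) g w - KK μ T g w - KK μ (insert j D) g w + KK μ D g w)^2
      ∂(Measure.pi μ) := integral_nonneg fun w => sq_nonneg _
  have e : ∀ w, (KK μ (insert j T) g w - KK μ T g w - KK μ (insert j D) g w + KK μ D g w)^2
     = (KK μ (insert j T) g w * KK μ (insert j T) g w + KK μ T g w * KK μ T g w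
      + KK μ (insert j D) g w * KK μ (insert j D) g w + KK μ D g w * KK μ D g w)
      + (2:ℝ) * (KK μ (insert j T) g w * KK μ D g w + KK μ T g w * KK μ (insert j D) g w
      - KK μ (insert j T) g w * KK μ T g w - KK μ (insert j T) g w * KK μ (insert j D) g w
      - KK μ T g w * KK μ D g w - KK μ (insert j D) g w * KK μ D g w) := fun w => by ring
  simp only [e] at h0
  rw [integral_add, integral_add, integral_add, integral_add, integral_const_mul, integral_sub,
    integral_sub, integral_sub, integral_sub, integral_add] at h0
  · simp only [I, Finset.inter_self] at h0
    have i1 : insert j T ∩ D = D := Finset.inter_eq_right.2 (hDT.trans (Finset.subset_insert _ _))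
    have i2 : T ∩ insert j D = D := by
      ext i; simp only [Finset.mem_inter, Finset.mem_insert]
      constructor
      · rintro ⟨h1, rfl | h2⟩
        · exact absurd h1 hj
        · exact h2
      · exact fun h => ⟨hDT h, Or.inr h⟩
    have i3 : insert j T ∩ T = T := Finset.inter_eq_right.2 (Finset.subset_insert _ _)
    have i4 : insert j T ∩ insert j D = insert j D :=
      Finset.inter_eq_right.2 (Finset.insert_subset_insert _ hDT)
    have i5 : T ∩ D = D := Finset.inter_eq_right.2 hDT
    have i6 : insert j D ∩ D = D := Finset.inter_eq_right.2 (Finset.subset_insert _ _)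
    rw [i1, i2, i3, i4, i5, i6] at h0
    linarith
  all_goals
    repeat' first | exact J _ _ | apply Integrable.sub | apply Integrable.add | apply Integrable.const_mul

lemma en_mono_empty (hg : Bd g) (S : Finset ι) : en μ g ∅ ≤ en μ g S := by
  induction S using Finset.induction_on with
  | empty => exact le_rfl
  | insert a s ha ih =>
    have h1 := en_supermod μ hg (D := ∅) (T := s) (j := a) (Finset.empty_subset _) ha
    have b := fun S => bd_KK μ S hg
    have h0 : 0 ≤ ∫ w, (KK μ (insert a s) g w - KK μ s g w)^2 ∂(Measure.pi μ) :=
      integral_nonneg fun w => sq_nonneg _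
    have e : ∀ w, (KK μ (insert a s) g w - KK μ s g w)^2
      = (KK μ (insert a s) g w * KK μ (insert a s) g w + KK μ s g w * KK μ s g w)
        - 2 * (KK μ (insert a s) g w * KK μ s g w) := fun w => by ring
    have J := fun S T => ((b S).mul (b T)).int (Measure.pi μ)
    simp only [e] at h0
    rw [integral_sub (((b _).mul (b _)).add ((b _).mul (b _)) |>.int _) ((J _ _).const_mul _),
      integral_add (J _ _) (J _ _), integral_const_mul] at h0
    simp only [en_inner μ _ _ hg, Finset.inter_self] at h0
    rw [Finset.inter_eq_right.2 (Finset.subset_insert a s)] at h0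
    linarith

/-- permutation invariance -/
lemma en_perm (hg : Bd g) (σ : Equiv.Perm ι) (hμ : ∀ i, μ (σ i) = μ i)
    (hgσ : ∀ w, g (w ∘ σ) = g w) (S : Finset ι) :
    en μ g (S.map σ.toEmbedding) = en μ g S := by
  unfold en
  rw [int_KK_mul μ _ hg hg, int_KK_mul μ _ hg hg]
  have hmp : MeasurePreserving (fun w : ι → ℝ => w ∘ σ) (Measure.pi μ) (Measure.pi μ) := by
    have hmm : Measurable (fun w : ι → ℝ => w ∘ σ) :=
      measurable_pi_lambda _ fun i => measurable_pi_apply (σ i)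
    refine ⟨hmm, ?_⟩
    symm
    refine Measure.pi_eq fun s hs => ?_
    rw [Measure.map_apply hmm (MeasurableSet.univ_pi hs)]
    have : (fun w : ι → ℝ => w ∘ σ) ⁻¹' (Set.pi Set.univ s)
        = Set.pi Set.univ (fun i => s (σ.symm i)) := by
      ext w
      simp only [Set.mem_preimage, Set.mem_pi, Set.mem_univ, forall_true_left, Function.comp]
      exact ⟨fun h i => by simpa using h (σ.symm i), fun h i => by simpa using h (σ i)⟩
    rw [this, Measure.pi_pi, ← Equiv.prod_comp σ]
    exact Finset.prod_congr rfl fun i _ => by simp [hμ]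
  have hb : Bd (fun q : (ι → ℝ) × (ι → ℝ) => g (mixmap S q) * g q.1) :=
    (hg.comp (measurable_mixmap S)).mul (hg.comp measurable_fst)
  rw [← mp_integral (hmp.prod hmp) hb.1]
  refine integral_congr_ae (Filter.Eventually.of_forall fun q => ?_)
  simp only [Prod.map_fst, hgσ]
  congr 1
  rw [← hgσ]
  congr 1
  funext i
  by_cases h : i ∈ S <;> simp [mixmap, h]

/-- pure combinatorial telescoping -/
lemma telescoping (e : Finset ι → ℝ)
    (he : ∀ (D T : Finset ι) (j : ι), D ⊆ T → j ∉ T → e (insert j D) - e D ≤ e (insert j T) - e T)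
    (A : Finset ι) : ∃ δ : ι → ℝ, ∑ j ∈ A, δ j = e A - e ∅ ∧ ∀ D ⊆ A, e D - e ∅ ≤ ∑ j ∈ D, δ j := by
  induction A using Finset.induction_on with
  | empty =>
    refine ⟨fun _ => 0, by simp, fun D hD => ?_⟩
    rw [Finset.subset_empty.1 hD]; simp
  | insert a A ha ih =>
    obtain ⟨δ, h1, h2⟩ := ih
    have hk : ∀ D : Finset ι, a ∉ D →
        ∑ j ∈ D, Function.update δ a (e (insert a A) - e A) j = ∑ j ∈ D, δ j := by
      intro D hD
      refine Finset.sum_congr rfl fun j hj => Function.update_of_ne ?_ _ _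
      rintro rfl; exact hD hj
    refine ⟨Function.update δ a (e (insert a A) - e A), ?_, fun D hD => ?_⟩
    · rw [Finset.sum_insert ha, hk A ha, h1, Function.update_self]; ring
    · by_cases h : a ∈ D
      · have hs : D.erase a ⊆ A := fun i hi => by
          have := hD (Finset.mem_of_mem_erase hi)
          rcases Finset.mem_insert.1 this with h' | h'
          · exact absurd h' (Finset.ne_of_mem_erase hi)
          · exact h'
        rw [← Finset.insert_erase h, Finset.sum_insert (Finset.notMem_erase a D),
          hk _ (Finset.notMem_erase a D), Function.update_self]
        have := he (D.erase a) A a hs ha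
        have := h2 _ hs
        linarith
      · rw [hk D h]
        refine h2 D fun i hi => ?_
        rcases Finset.mem_insert.1 (hD hi) with h' | h'
        · exact absurd (h' ▸ hi) h
        · exact h'

lemma averaging (e : Finset ι → ℝ)
    (he : ∀ (D T : Finset ι) (j : ι), D ⊆ T → j ∉ T → e (insert j D) - e D ≤ e (insert j T) - e T)
    (A D : Finset ι) (Γ : Subgroup (Equiv.Perm ι))
    (hinv : ∀ σ ∈ Γ, ∀ U : Finset ι, e (U.map σ.toEmbedding) = e U)
    (hA : ∀ σ ∈ Γ, ∀ j ∈ A, σ j ∈ A)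
    (htr : ∀ j ∈ A, ∀ k ∈ A, ∃ σ ∈ Γ, σ j = k) (hD : D ⊆ A) (hcard : 2 * D.card ≤ A.card)
    (h0 : e ∅ ≤ e A) : e D ≤ (e ∅ + e A) / 2 := by
  classical
  obtain ⟨δ, h1, h2⟩ := telescoping e he A
  rcases D.eq_empty_or_nonempty with rfl | ⟨d, hd⟩
  · linarith
  have hdA := hD hd
  let F : ι → ℝ := fun j => ∑ σ : Γ, δ ((σ : Equiv.Perm ι) j)
  have hF : ∀ j ∈ A, F j = F d := by
    intro j hj
    obtain ⟨τ, hτ, rfl⟩ := htr d hdA j hj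
    exact Equiv.sum_comp (Equiv.mulRight (⟨τ, hτ⟩ : Γ)) (fun σ : Γ => δ ((σ : Equiv.Perm ι) d))
  have hperm : ∀ σ : Γ, ∑ j ∈ A, δ ((σ : Equiv.Perm ι) j) = ∑ j ∈ A, δ j := by
    intro σ
    have : A.map (σ : Equiv.Perm ι).toEmbedding = A := by
      refine Finset.eq_of_subset_of_card_le ?_ (by simp)
      intro k hk
      obtain ⟨j, hj, rfl⟩ := Finset.mem_map.1 hk
      exact hA σ σ.2 j hj
    conv_rhs => rw [← this, Finset.sum_map]
    rfl
  have s1 : (A.card : ℝ) * F d = (Fintype.card Γ : ℝ) * (e A - e ∅) := by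
    calc (A.card : ℝ) * F d = ∑ j ∈ A, F j := by
          rw [Finset.sum_congr rfl hF]; simp
      _ = ∑ σ : Γ, ∑ j ∈ A, δ ((σ : Equiv.Perm ι) j) := Finset.sum_comm
      _ = _ := by
          rw [Finset.sum_congr rfl fun σ _ => hperm σ, h1]; simp [mul_sub]
  have s2 : (Fintype.card Γ : ℝ) * (e D - e ∅) ≤ D.card * F d := by
    calc (Fintype.card Γ : ℝ) * (e D - e ∅) = ∑ σ : Γ, (e D - e ∅) := by simp [mul_sub]
      _ ≤ ∑ σ : Γ, ∑ j ∈ D, δ ((σ : Equiv.Perm ι) j) := by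
          refine Finset.sum_le_sum fun σ _ => ?_
          have := h2 (D.map (σ : Equiv.Perm ι).toEmbedding) (fun k hk => by
            obtain ⟨j, hj, rfl⟩ := Finset.mem_map.1 hk
            exact hA σ σ.2 j (hD hj))
          rw [hinv σ σ.2, Finset.sum_map] at this
          exact this
      _ = ∑ j ∈ D, F j := Finset.sum_comm
      _ = _ := by rw [Finset.sum_congr rfl fun j hj => hF j (hD hj)]; simp
  have cA : (0:ℝ) < A.card := by exact_mod_cast Finset.card_pos.2 ⟨d, hdA⟩
  have cG : (0:ℝ) < Fintype.card Γ := by exact_mod_cast Fintype.card_pos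
  have hc : 2 * (D.card : ℝ) ≤ A.card := by exact_mod_cast hcard
  have hFd : 0 ≤ F d := by
    by_contra hneg
    push Not at hneg
    have : (Fintype.card Γ : ℝ) * (e A - e ∅) < 0 := by rw [← s1]; exact mul_neg_of_pos_of_neg cA hneg
    have : 0 ≤ (Fintype.card Γ : ℝ) * (e A - e ∅) := mul_nonneg cG.le (by linarith)
    linarith
  have : (Fintype.card Γ : ℝ) * (2 * (e D - e ∅)) ≤ (Fintype.card Γ : ℝ) * (e A - e ∅) := by
    rw [← s1]; nlinarith
  have := le_of_mul_le_mul_left this cG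
  linarith

/-- `g` depends (a.e.) only on the coordinates in `A` -/
def Dep (A : Finset ι) (g : (ι → ℝ) → ℝ) : Prop :=
  ∀ᵐ q ∂((Measure.pi μ).prod (Measure.pi μ)), g (mixmap A q) = g q.1

lemma dep_int {A : Finset ι} (h : Dep μ A g) (hg : Bd g) (hf : Bd f) :
    ∫ w, g w * f w ∂(Measure.pi μ) = ∫ w, KK μ A g w * f w ∂(Measure.pi μ) := by
  rw [int_KK_mul μ A hg hf]
  have : ∫ q, g (mixmap A q) * f q.1 ∂((Measure.pi μ).prod (Measure.pi μ))
      = ∫ q, (g q.1 * f q.1) ∂((Measure.pi μ).prod (Measure.pi μ)) := by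
    refine integral_congr_ae (h.mono fun q hq => ?_)
    simp only [hq]
  rw [this]
  exact (mp_integral (measurePreserving_fst (μ := Measure.pi μ) (ν := Measure.pi μ)) (hg.mul hf).1).symm

lemma two_dep {A B : Finset ι} (hA : Dep μ A g) (hB : Dep μ B f) (hg : Bd g) (hf : Bd f) :
    ∫ w, g w * f w ∂(Measure.pi μ) ≤ (en μ g (A ∩ B) + en μ f (A ∩ B)) / 2 := by
  have h1 : ∫ w, g w * f w ∂(Measure.pi μ)
      = ∫ w, KK μ (A ∩ B) g w * KK μ (A ∩ B) f w ∂(Measure.pi μ) := by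
    rw [dep_int μ hA hg hf, KK_inner μ _ _ hg hf, Finset.inter_self]
    have : ∀ w, KK μ A g w * f w = f w * KK μ A g w := fun w => mul_comm _ _
    simp only [this]
    rw [dep_int μ hB hf (bd_KK μ A hg)]
    have : ∀ w, KK μ B f w * KK μ A g w = KK μ A g w * KK μ B f w := fun w => mul_comm _ _
    simp only [this]
    exact KK_inner μ _ _ hg hf
  have b1 := bd_KK μ (A ∩ B) hg
  have b2 := bd_KK μ (A ∩ B) hf
  have e1 := en_inner μ (A ∩ B) (A ∩ B) hg
  have e2 := en_inner μ (A ∩ B) (A ∩ B) hf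
  rw [Finset.inter_self] at e1 e2
  rw [h1, ← e1, ← e2, ← integral_add ((b1.mul b1).int _) ((b2.mul b2).int _), ← integral_div]
  refine integral_mono ((b1.mul b2).int _) (((b1.mul b1).add (b2.mul b2)).int _ |>.div_const 2) fun w => ?_
  simp only
  nlinarith [sq_nonneg (KK μ (A ∩ B) g w - KK μ (A ∩ B) f w)]

lemma dep_univ {A : Finset ι} (h : Dep μ A g) (hg : Bd g) :
    en μ g A = ∫ w, (g w)^2 ∂(Measure.pi μ) := by
  unfold en
  rw [← dep_int μ h hg hg]; simp only [sq]

end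
end RMP

open MeasureTheory ProbabilityTheory
set_option linter.unusedSectionVars false
set_option linter.unusedVariables false
namespace RMP
noncomputable section
variable {ι : Type*} [Fintype ι] [DecidableEq ι]
variable {κ : ℝ → ℝ} {C : Finset (ι → ℝ)}
variable {l P : Measure ℝ} [IsProbabilityMeasure l] [IsProbabilityMeasure P]

lemma dens_pos_ae (h : BMS κ l P) (t : ι → unitInterval) : ∀ᵐ w ∂(piM t P), 0 < dens κ w := by
  rw [piM_dens h t, ae_withDensity_iff (measurable_dens h.ker).ennreal_ofReal]
  refine Filter.Eventually.of_forall fun w hw => ?_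
  simpa using hw

lemma dens_le_pc (h : Ker κ) (hC : IsCode C) (w : ι → ℝ) : dens κ w / C.card ≤ pc κ C w := by
  unfold pc
  refine div_le_div_of_nonneg_right ?_ hC.card_pos.le
  have := Finset.single_le_sum (f := fun x : ι → ℝ => ∏ i, (1 + x i * κ (w i))) (s := C)
    (fun x hx => term_nonneg h (hC.sign x hx) w) hC.one
  simpa [dens] using this

lemma pc_pos_ae (h : BMS κ l P) (hC : IsCode C) (t : ι → unitInterval) :
    ∀ᵐ w ∂(piM t P), 0 < pc κ C w :=
  (dens_pos_ae h t).mono fun w hw => (div_pos hw hC.card_pos).trans_le (dens_le_pc h.ker hC w)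

lemma split_sum (hC : IsCode C) (A : Finset ι) (hA : ∀ x ∈ C, A.piecewise x 1 ∈ C)
    (u : ι → ℝ) (χ : (ι → ℝ) → ℝ) (hχ : ∀ x y, (∀ i ∈ A, x i = y i) → χ x = χ y) :
    (∑ x ∈ C, χ x * ∏ i, (1 + x i * u i)) * C.card
      = (∑ x ∈ C, χ x * ∏ i ∈ A, (1 + x i * u i)) * (∑ y ∈ C, ∏ i ∈ Aᶜ, (1 + y i * u i)) := by
  have hA' : ∀ y ∈ C, A.piecewise (1 : ι → ℝ) y ∈ C := by
    intro y hy
    have : A.piecewise (1 : ι → ℝ) y = A.piecewise y 1 * y := by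
      funext i
      by_cases h : i ∈ A
      · simp [h, (hC.sign y hy).sq i]
      · simp [h]
    rw [this]; exact hC.mul _ (hA y hy) _ hy
  have h1 : ∀ y ∈ C, ∑ x ∈ C, χ x * ∏ i, (1 + x i * u i)
      = ∑ x ∈ C, (χ x * ∏ i ∈ A, (1 + x i * u i)) * ∏ i ∈ Aᶜ, (1 + (y * x) i * u i) := by
    intro y hy
    rw [← sum_shift hC (hA' y hy)]
    refine Finset.sum_congr rfl fun x _ => ?_
    rw [← Finset.prod_mul_prod_compl A, ← mul_assoc]
    congr 1
    · congr 1
      · refine hχ _ _ fun i hi => by simp [hi]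
      · refine Finset.prod_congr rfl fun i hi => by simp [hi]
    · refine Finset.prod_congr rfl fun i hi => ?_
      have := Finset.mem_compl.1 hi
      simp [this, mul_comm]
  calc (∑ x ∈ C, χ x * ∏ i, (1 + x i * u i)) * C.card
      = ∑ y ∈ C, ∑ x ∈ C, χ x * ∏ i, (1 + x i * u i) := by
        rw [Finset.sum_const, nsmul_eq_mul, mul_comm]
    _ = ∑ y ∈ C, ∑ x ∈ C, (χ x * ∏ i ∈ A, (1 + x i * u i)) * ∏ i ∈ Aᶜ, (1 + (y * x) i * u i) :=
        Finset.sum_congr rfl h1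
    _ = ∑ x ∈ C, ∑ y ∈ C, (χ x * ∏ i ∈ A, (1 + x i * u i)) * ∏ i ∈ Aᶜ, (1 + (y * x) i * u i) :=
        Finset.sum_comm
    _ = ∑ x ∈ C, (χ x * ∏ i ∈ A, (1 + x i * u i)) * ∑ y ∈ C, ∏ i ∈ Aᶜ, (1 + y i * u i) := by
        refine Finset.sum_congr rfl fun x hx => ?_
        rw [← Finset.mul_sum, sum_shift hC hx (fun y => ∏ i ∈ Aᶜ, (1 + y i * u i))]
    _ = _ := by rw [Finset.sum_mul]

lemma Wc_split (h : Ker κ) (hC : IsCode C) (A : Finset ι) (hA : ∀ x ∈ C, A.piecewise x 1 ∈ C)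
    (o : ι) (ho : o ∈ A) (w w' : ι → ℝ) (hw : ∀ i ∈ A, w i = w' i) (hp : 0 < pc κ C w)
    (hp' : 0 < pc κ C w') : Wc κ C o w = Wc κ C o w' := by
  have cp := hC.card_pos
  have key : ∀ v : ι → ℝ, 0 < pc κ C v → Wc κ C o v
      = (∑ x ∈ C, x o * ∏ i ∈ A, (1 + x i * κ (v i))) / (∑ x ∈ C, ∏ i ∈ A, (1 + x i * κ (v i))) := by
    intro v hv
    have s1 := split_sum hC A hA (fun i => κ (v i)) (fun x => x o) (fun x y e => e o ho)
    have s2 := split_sum hC A hA (fun i => κ (v i)) (fun x => 1) (fun x y e => rfl)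
    simp only [one_mul] at s2
    unfold pc at hv
    have hv' : 0 < (∑ x ∈ C, ∏ i, (1 + x i * κ (v i))) := by
      by_contra hn; push Not at hn
      exact absurd hv (not_lt.2 (div_nonpos_of_nonpos_of_nonneg hn cp.le))
    have hne : (∑ x ∈ C, ∏ i ∈ A, (1 + x i * κ (v i))) * (∑ y ∈ C, ∏ i ∈ Aᶜ, (1 + y i * κ (v i))) ≠ 0 := by
      rw [← s2]; exact (mul_pos hv' cp).ne'
    have n1 := left_ne_zero_of_mul hne
    have n2 := right_ne_zero_of_mul hne
    unfold Wc nc pc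
    rw [div_div_div_cancel_right₀ cp.ne', ← mul_div_mul_right _ _ cp.ne', s1, s2,
      mul_div_mul_right _ _ n2]
  rw [key w hp, key w' hp']
  have e : ∀ x : ι → ℝ, ∏ i ∈ A, (1 + x i * κ (w i)) = ∏ i ∈ A, (1 + x i * κ (w' i)) :=
    fun x => Finset.prod_congr rfl fun i hi => by rw [hw i hi]
  simp only [e]

lemma dep_Wc (h : BMS κ l P) (hC : IsCode C) (A : Finset ι) (hA : ∀ x ∈ C, A.piecewise x 1 ∈ C)
    (o : ι) (ho : o ∈ A) (t : ι → unitInterval) (hto : t o = 0) :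
    Dep (fun i => mix (t i) P) (A.erase o) (Wc κ C o) := by
  unfold Dep
  have z := piM_zero_ae t o hto P
  have pp := pc_pos_ae h hC t
  unfold piM at z pp
  have a1 := measurePreserving_fst (μ := Measure.pi fun i => mix (t i) P)
    (ν := Measure.pi fun i => mix (t i) P) |>.quasiMeasurePreserving.ae (z.and pp)
  have a2 := measurePreserving_snd (μ := Measure.pi fun i => mix (t i) P)
    (ν := Measure.pi fun i => mix (t i) P) |>.quasiMeasurePreserving.ae (z.and pp)
  have a3 := (mp_mixmap (fun i => mix (t i) P) (A.erase o)).quasiMeasurePreserving.ae (z.and pp)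
  filter_upwards [a1, a2, a3] with q h1 h2 h3
  refine Wc_split h.ker hC A hA o ho _ _ ?_ h3.2 h1.2
  intro i hi
  by_cases e : i = o
  · rw [e, h3.1, h1.1]
  · simp [mixmap, e, hi]

lemma bd_Wc (h : Ker κ) (hC : IsCode C) (o : ι) : Bd (Wc κ C o) :=
  ⟨measurable_Wc h C o, 1, abs_Wc_le h hC o⟩

lemma mp_perm (μ : ι → Measure ℝ) [∀ i, IsProbabilityMeasure (μ i)] (σ : Equiv.Perm ι) :
    MeasurePreserving (fun w : ι → ℝ => w ∘ σ) (Measure.pi μ) (Measure.pi fun i => μ (σ i)) := by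
  have hmm : Measurable (fun w : ι → ℝ => w ∘ σ) :=
    measurable_pi_lambda _ fun i => measurable_pi_apply (σ i)
  refine ⟨hmm, ?_⟩
  symm
  refine Measure.pi_eq fun s hs => ?_
  rw [Measure.map_apply hmm (MeasurableSet.univ_pi hs)]
  have : (fun w : ι → ℝ => w ∘ σ) ⁻¹' (Set.pi Set.univ s)
      = Set.pi Set.univ (fun i => s (σ.symm i)) := by
    ext w
    simp only [Set.mem_preimage, Set.mem_pi, Set.mem_univ, forall_true_left, Function.comp]
    exact ⟨fun h i => by simpa using h (σ.symm i), fun h i => by simpa using h (σ i)⟩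
  rw [this, Measure.pi_pi, ← Equiv.prod_comp σ]
  exact Finset.prod_congr rfl fun i _ => by simp

lemma sum_perm {C' : Finset (ι → ℝ)} (σ : Equiv.Perm ι) (hσ : ∀ x, x ∈ C ↔ x ∘ σ ∈ C')
    (F : (ι → ℝ) → ℝ) : ∑ y ∈ C', F y = ∑ x ∈ C, F (x ∘ σ) := by
  symm
  refine Finset.sum_bij' (fun x _ => x ∘ σ) (fun y _ => y ∘ σ.symm) ?_ ?_ ?_ ?_ ?_
  · exact fun x hx => (hσ x).1 hx
  · intro y hy
    rw [hσ]
    have : (y ∘ σ.symm) ∘ σ = y := by funext i; simp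
    rwa [this]
  · intro x _; funext i; simp
  · intro x _; funext i; simp
  · exact fun x _ => rfl

lemma Wc_perm {C' : Finset (ι → ℝ)} (σ : Equiv.Perm ι) (hσ : ∀ x, x ∈ C ↔ x ∘ σ ∈ C')
    (o : ι) (w : ι → ℝ) : Wc κ C' o (w ∘ σ) = Wc κ C (σ o) w := by
  have hc : (C'.card : ℝ) = C.card := by
    have := sum_perm σ hσ (fun _ => 1)
    simpa using this
  unfold Wc nc pc
  rw [hc, sum_perm σ hσ, sum_perm σ hσ]
  have e : ∀ x : ι → ℝ, ∏ i, (1 + (x ∘ σ) i * κ ((w ∘ σ) i)) = ∏ i, (1 + x i * κ (w i)) :=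
    fun x => Equiv.prod_comp σ (fun i => 1 + x i * κ (w i))
  simp only [e]
  rfl

/-- symmetry group -/
def stab (C : Finset (ι → ℝ)) (o : ι) (A : Finset ι) : Subgroup (Equiv.Perm ι) where
  carrier := {σ | σ o = o ∧ (∀ x, x ∈ C ↔ x ∘ σ ∈ C) ∧ ∀ i, σ i ∈ A ↔ i ∈ A}
  mul_mem' := by
    rintro a b ⟨a1, a2, a3⟩ ⟨b1, b2, b3⟩
    refine ⟨by simp [b1, a1], fun x => ?_, fun i => ?_⟩
    · rw [a2, b2]; rfl
    · rw [Equiv.Perm.mul_apply, a3, b3]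
  one_mem' := ⟨rfl, fun x => by simp, fun i => by simp⟩
  inv_mem' := by
    rintro a ⟨a1, a2, a3⟩
    refine ⟨by rw [Equiv.Perm.inv_eq_iff_eq]; exact a1.symm, fun x => ?_, fun i => ?_⟩
    · rw [a2 (x ∘ (a⁻¹ : Equiv.Perm ι))]
      have : (x ∘ (a⁻¹ : Equiv.Perm ι)) ∘ a = x := by funext i; simp
      rw [this]
    · rw [← a3]; simp

/-- erased time vector -/
def tt (o : ι) (t : unitInterval) : ι → unitInterval := Function.update (fun _ => t) o 0

lemma tt_perm (o : ι) (t : unitInterval) (σ : Equiv.Perm ι) (hσ : σ o = o) (i : ι) :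
    tt o t (σ i) = tt o t i := by
  unfold tt
  by_cases e : i = o
  · subst e; rw [hσ]
  · have : σ i ≠ o := fun h => e (σ.injective (h.trans hσ.symm))
    rw [Function.update_of_ne e, Function.update_of_ne this]

/-- combinatorial data for the two-look argument -/
structure TwoLook (C CA CB : Finset (ι → ℝ)) (o : ι) (A B : Finset ι) : Prop where
  hC : IsCode C
  hCA : IsCode CA
  hCB : IsCode CB
  sA : C ⊆ CA
  sB : C ⊆ CB
  oA : o ∈ A
  oB : o ∈ B
  splitA : ∀ x ∈ CA, A.piecewise x 1 ∈ CA
  splitB : ∀ x ∈ CB, B.piecewise x 1 ∈ CB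
  symA : ∀ j ∈ A.erase o, ∀ k ∈ A.erase o, ∃ σ ∈ stab CA o A, σ j = k
  symB : ∀ j ∈ B.erase o, ∀ k ∈ B.erase o, ∃ σ ∈ stab CB o B, σ j = k
  swap : ∃ τ : Equiv.Perm ι, τ o = o ∧ ∀ x, x ∈ CA ↔ x ∘ τ ∈ CB
  cardA : 2 * (A.erase o ∩ B.erase o).card ≤ (A.erase o).card
  cardB : 2 * (A.erase o ∩ B.erase o).card ≤ (B.erase o).card

lemma en_half (h : BMS κ l P) (hC : IsCode C) (o : ι) (A D : Finset ι) (ho : o ∈ A) (t : unitInterval)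
    (hA : ∀ x ∈ C, A.piecewise x 1 ∈ C)
    (sym : ∀ j ∈ A.erase o, ∀ k ∈ A.erase o, ∃ σ ∈ stab C o A, σ j = k)
    (hD : D ⊆ A.erase o) (hcard : 2 * D.card ≤ (A.erase o).card) :
    en (fun i => mix (tt o t i) P) (Wc κ C o) D
      ≤ ((alpha κ C o (piM (tt o t) P))^2 + alpha κ C o (piM (tt o t) P)) / 2 := by
  have hto : tt o t o = 0 := by simp [tt]
  have b := bd_Wc h.ker hC o
  have dep := dep_Wc h hC A hA o ho (tt o t) hto
  have h1 := averaging (en (fun i => mix (tt o t i) P) (Wc κ C o))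
    (fun D T j hDT hj => en_supermod _ b hDT hj) (A.erase o) D (stab C o A)
    (fun σ hσ U => en_perm _ b σ (fun i => by rw [tt_perm o t σ hσ.1])
      (fun w => by rw [Wc_perm σ hσ.2.1, hσ.1]) U)
    (fun σ hσ j hj => by
      rw [Finset.mem_erase] at hj ⊢
      exact ⟨fun e => hj.1 (σ.injective (e.trans hσ.1.symm)), (hσ.2.2 j).2 hj.2⟩)
    sym hD hcard (en_mono_empty _ b _)
  rw [en_empty, dep_univ _ dep b] at h1
  have e := alpha_eq h hC (tt o t) o
  unfold alpha at e ⊢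
  unfold piM at e ⊢
  rw [← e] at h1
  exact h1

lemma two_look {CA CB : Finset (ι → ℝ)} {o : ι} {A B : Finset ι} (h : BMS κ l P)
    (L : TwoLook C CA CB o A B) (t : unitInterval) :
    alpha κ CA o (piM (tt o t) P) * (1 - alpha κ CA o (piM (tt o t) P)) / 4
      ≤ alpha κ C o (piM (tt o t) P) - alpha κ CA o (piM (tt o t) P) := by
  have hto : tt o t o = 0 := by simp [tt]
  have bC := bd_Wc h.ker L.hC o
  have bA := bd_Wc h.ker L.hCA o
  have bB := bd_Wc h.ker L.hCB o
  have depA := dep_Wc h L.hCA A L.splitA o L.oA (tt o t) hto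
  have depB := dep_Wc h L.hCB B L.splitB o L.oB (tt o t) hto
  have eA := en_half h L.hCA o A (A.erase o ∩ B.erase o) L.oA t L.splitA L.symA
    Finset.inter_subset_left L.cardA
  have eB := en_half h L.hCB o B (A.erase o ∩ B.erase o) L.oB t L.splitB L.symB
    Finset.inter_subset_right L.cardB
  have c1 := two_dep _ depA depB bA bB
  have hab : alpha κ CB o (piM (tt o t) P) = alpha κ CA o (piM (tt o t) P) := by
    obtain ⟨τ, hτo, hτ⟩ := L.swap
    have := mp_perm (fun i => mix (tt o t i) P) τ
    simp only [tt_perm o t τ hτo] at this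
    have := mp_integral this (bB.mul bB).1
    unfold alpha piM
    simp only [sq]
    rw [← this]
    simp only [Wc_perm τ hτ, hτo]
  rw [hab] at eB
  change ∫ w, Wc κ CA o w * Wc κ CB o w ∂(piM (tt o t) P) ≤ _ at c1
  have n1 := nish_sub h L.hC L.hCA L.sA (tt o t) o
  have n2 := nish_sub h L.hC L.hCB L.sB (tt o t) o
  rw [← alpha_eq h L.hCA (tt o t) o] at n1
  rw [← alpha_eq h L.hCB (tt o t) o, hab] at n2
  have a0 := alpha_nonneg (κ := κ) (C := CA) o (piM (tt o t) P)
  have a1 := alpha_le_one h.ker L.hCA o (piM (tt o t) P)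
  have dC : alpha κ C o (piM (tt o t) P) = ∫ w, Wc κ C o w * Wc κ C o w ∂(piM (tt o t) P) := by
    unfold alpha; simp only [sq]
  have dA : alpha κ CA o (piM (tt o t) P) = ∫ w, Wc κ CA o w * Wc κ CA o w ∂(piM (tt o t) P) := by
    unfold alpha; simp only [sq]
  have dB : alpha κ CA o (piM (tt o t) P) = ∫ w, Wc κ CB o w * Wc κ CB o w ∂(piM (tt o t) P) := by
    rw [← hab]; unfold alpha; simp only [sq]
  have sq0 : ∀ θ : ℝ, 0 ≤ ∫ w, (Wc κ C o w - θ * (Wc κ CA o w + Wc κ CB o w))^2 ∂(piM (tt o t) P) :=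
    fun θ => integral_nonneg fun w => sq_nonneg _
  set a := alpha κ CA o (piM (tt o t) P)
  set α := alpha κ C o (piM (tt o t) P)
  have ex : ∀ θ : ℝ, ∫ w, (Wc κ C o w - θ * (Wc κ CA o w + Wc κ CB o w))^2 ∂(piM (tt o t) P)
      = α - 4 * θ * a + θ^2 * (2 * a + 2 * ∫ w, Wc κ CA o w * Wc κ CB o w ∂(piM (tt o t) P)) := by
    intro θ
    have e : ∀ w, (Wc κ C o w - θ * (Wc κ CA o w + Wc κ CB o w))^2
      = Wc κ C o w * Wc κ C o w + (-2 * θ) * (Wc κ C o w * Wc κ CA o w)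
        + (-2 * θ) * (Wc κ C o w * Wc κ CB o w) + θ^2 * (Wc κ CA o w * Wc κ CA o w)
        + θ^2 * (Wc κ CB o w * Wc κ CB o w) + (2 * θ^2) * (Wc κ CA o w * Wc κ CB o w) :=
      fun w => by ring
    simp only [e]
    have j1 := (bC.mul bC)
    have j2 := ((bC.mul bA).const_mul (-2 * θ))
    have j3 := ((bC.mul bB).const_mul (-2 * θ))
    have j4 := ((bA.mul bA).const_mul (θ^2))
    have j5 := ((bB.mul bB).const_mul (θ^2))
    have j6 := ((bA.mul bB).const_mul (2 * θ^2))
    rw [integral_add (((((j1.add j2).add j3).add j4).add j5).int _) (j6.int _),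
      integral_add ((((j1.add j2).add j3).add j4).int _) (j5.int _),
      integral_add (((j1.add j2).add j3).int _) (j4.int _),
      integral_add ((j1.add j2).int _) (j3.int _), integral_add (j1.int _) (j2.int _)]
    simp only [integral_const_mul]
    rw [n1, n2, ← dA, ← dB, ← dC]
    ring
  have hθ := sq0 (2 / (3 + a))
  rw [ex] at hθ
  have hc : ∫ w, Wc κ CA o w * Wc κ CB o w ∂(piM (tt o t) P) ≤ (a^2 + a) / 2 := by linarith
  have h3 : 0 < 3 + a := by linarith
  have hθ2 : 0 ≤ α - 4 * (2 / (3 + a)) * a + (2 / (3 + a))^2 * (3 * a + a^2) := by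
    refine hθ.trans ?_
    have : (2 / (3 + a))^2 * (2 * a + 2 * ∫ w, Wc κ CA o w * Wc κ CB o w ∂(piM (tt o t) P))
      ≤ (2 / (3 + a))^2 * (3 * a + a^2) := mul_le_mul_of_nonneg_left (by linarith) (sq_nonneg _)
    linarith
  have e2 : α - 4 * (2 / (3 + a)) * a + (2 / (3 + a))^2 * (3 * a + a^2) = α - 4 * a / (3 + a) := by
    field_simp; ring
  rw [e2] at hθ2
  have e3 : 4 * a / (3 + a) - a = a * (1 - a) / (3 + a) := by field_simp; ring
  have e4 : a * (1 - a) / 4 ≤ a * (1 - a) / (3 + a) :=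
    div_le_div_of_nonneg_left (mul_nonneg a0 (by linarith)) h3 (by linarith)
  linarith

/-- degradation (6) -/
lemma alpha_mono (h : BMS κ l P) (hC : IsCode C) (o : ι) (t : ι → unitInterval) :
    alpha κ C o (piM t P) ≤ alpha κ C o (piM (fun _ => 1) P) := by
  have b := bd_Wc h.ker hC o
  have ea := alpha_eq h hC t o
  have x1 := integral_expand t P (Wc κ C o) b.1 1 (abs_Wc_le h.ker hC o)
  have x2 := integral_expand t P (fun w => (Wc κ C o w)^2) (b.1.pow_const 2) 1
    (fun w => sq_le_one_of_abs (abs_Wc_le h.ker hC o w))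
  have hpi : Measure.pi (fun _ : ι => P) = piM (fun _ => 1) P := by simp [piM, mix_one]
  rw [hpi] at x1 x2
  set α1 := alpha κ C o (piM (fun _ => 1) P) with hα1
  have key : ∀ S : Finset ι, 0 ≤ α1 - 2 * ∫ w, Wc κ C o (mask S w) ∂(piM (fun _ => 1) P)
      + ∫ w, (Wc κ C o (mask S w))^2 ∂(piM (fun _ => 1) P) := by
    intro S
    have bS := b.comp (measurable_mask S)
    have n := nish h hC (fun _ => 1) o (fun w => Wc κ C o (mask S w)) bS.1 1
      (fun w => abs_Wc_le h.ker hC o _) (fun x hx w => by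
        rw [← Wc_flip h.ker hC o hx]
        congr 1
        funext i; by_cases e : i ∈ S <;> simp [mask, e])
    have h0 : 0 ≤ ∫ w, (Wc κ C o w - Wc κ C o (mask S w))^2 ∂(piM (fun _ => 1) P) :=
      integral_nonneg fun w => sq_nonneg _
    have e : ∀ w, (Wc κ C o w - Wc κ C o (mask S w))^2 = (Wc κ C o w)^2
        + (-2) * (Wc κ C o w * Wc κ C o (mask S w)) + Wc κ C o (mask S w) * Wc κ C o (mask S w) :=
      fun w => by ring
    have bs : Bd (fun w => Wc κ C o w ^ 2) := by simpa only [sq] using b.mul b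
    simp only [e] at h0
    rw [integral_add ((bs.add ((b.mul bS).const_mul (-2))).int _) ((bS.mul bS).int _),
      integral_add (bs.int _) (((b.mul bS).const_mul (-2)).int _), integral_const_mul, n] at h0
    simp only [sq] at h0 ⊢
    simp only [hα1, alpha, sq]
    linarith
  have := Finset.sum_nonneg (s := Finset.univ) fun S _ => mul_nonneg (pw_nonneg t S) (key S)
  simp only [mul_add, mul_sub, Finset.sum_add_distrib, Finset.sum_sub_distrib] at this
  rw [← Finset.sum_mul, sum_pw, ← x2] at this
  have e5 : ∑ S, pw (fun i => (t i : ℝ)) S * (2 * ∫ w, Wc κ C o (mask S w) ∂(piM (fun _ => 1) P))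
      = 2 * ∫ w, Wc κ C o w ∂(piM t P) := by
    rw [x1, Finset.mul_sum]; exact Finset.sum_congr rfl fun S _ => by ring
  rw [e5, ← ea] at this
  change 0 ≤ 1 * α1 - 2 * alpha κ C o (piM t P) + alpha κ C o (piM t P) at this
  linarith

end
end RMP

open MeasureTheory ProbabilityTheory
set_option linter.unusedSectionVars false
set_option linter.unusedVariables false
namespace RMP
noncomputable section
variable {ι : Type*} [Fintype ι] [DecidableEq ι]
variable {κ : ℝ → ℝ} {C : Finset (ι → ℝ)}
variable {l P : Measure ℝ} [IsProbabilityMeasure l] [IsProbabilityMeasure P]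

lemma abs_mul_le_one {a b : ℝ} (ha : |a| ≤ 1) (hb : |b| ≤ 1) : |a * b| ≤ 1 := by
  rw [abs_mul]; exact mul_le_one₀ ha (abs_nonneg _) hb

lemma bd_phiW (h : Ker κ) (hC : IsCode C) (o : ι) {k : ℝ} (hk : |k| ≤ 1) :
    Bd (fun w => phi (k * Wc κ C o w)) :=
  ⟨continuous_phi.measurable.comp ((measurable_Wc h C o).const_mul k), 1,
    fun w => abs_phi_le (abs_mul_le_one hk (abs_Wc_le h hC o w))⟩

/-- half log-likelihood -/
def LL (y : ℝ) : ℝ := (Real.log (1 + y) - Real.log (1 - y)) / 2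

lemma LL_neg (y : ℝ) : LL (-y) = - LL y := by
  unfold LL; rw [sub_neg_eq_add, ← sub_eq_add_neg]; ring

lemma measurable_LL : Measurable LL := by unfold LL; fun_prop

lemma LL_bdd {k y : ℝ} (hk : |k| < 1) (hy : |y| ≤ |k|) :
    |LL y| ≤ (|Real.log (1 - |k|)| + Real.log 2) := by
  have hy' := abs_le.1 hy
  have key : ∀ z : ℝ, |z| ≤ |k| → |Real.log (1 + z)| ≤ |Real.log (1 - |k|)| + Real.log 2 := by
    intro z hz
    have hz' := abs_le.1 hz
    have h2 : 0 ≤ Real.log 2 := Real.log_nonneg (by norm_num)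
    rw [abs_le]
    constructor
    · have : Real.log (1 - |k|) ≤ Real.log (1 + z) := Real.log_le_log (by linarith) (by linarith)
      have := neg_abs_le (Real.log (1 - |k|))
      linarith
    · have : Real.log (1 + z) ≤ Real.log 2 := Real.log_le_log (by linarith) (by linarith)
      have := abs_nonneg (Real.log (1 - |k|))
      linarith
  have a := key y hy
  have b := key (-y) (by rwa [abs_neg])
  rw [← sub_eq_add_neg] at b
  unfold LL
  rw [abs_div, abs_two, div_le_iff₀ two_pos]
  have := abs_sub (Real.log (1 + y)) (Real.log (1 - y))
  linarith

lemma gap_lt (h : BMS κ l P) (hC : IsCode C) {C' : Finset (ι → ℝ)} (hC' : IsCode C') (hs : C ⊆ C')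
    (t : ι → unitInterval) (o : ι) {k : ℝ} (hk : |k| < 1) :
    k^2 / 2 * (alpha κ C o (piM t P) - alpha κ C' o (piM t P))
      ≤ ∫ w, phi (k * Wc κ C o w) ∂(piM t P) - ∫ w, phi (k * Wc κ C' o w) ∂(piM t P) := by
  have bV := bd_Wc h.ker hC o
  have bU := bd_Wc h.ker hC' o
  have hle : ∀ w, |k * Wc κ C' o w| ≤ |k| := fun w => by
    rw [abs_mul]; exact mul_le_of_le_one_right (abs_nonneg _) (abs_Wc_le h.ker hC' o w)
  have bL : Bd (fun w => LL (k * Wc κ C' o w)) :=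
    ⟨measurable_LL.comp (bU.1.const_mul k), _, fun w => LL_bdd hk (hle w)⟩
  have sgn : ∀ x ∈ C', ∀ w, LL (k * Wc κ C' o (x * w)) = x o * LL (k * Wc κ C' o w) := by
    intro x hx w
    rw [Wc_flip h.ker hC' o hx]
    rcases (hC'.sign x hx) o with e | e <;> rw [e]
    · simp
    · rw [neg_one_mul (LL _), ← LL_neg]; congr 1; ring
  obtain ⟨c, hc⟩ := bL.2
  have n1 := nish h hC t o _ bL.1 c hc (fun x hx w => sgn x (hs hx) w)
  have n2 := nish h hC' t o _ bL.1 c hc sgn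
  have n3 := nish_sub h hC hC' hs t o
  rw [← alpha_eq h hC' t o] at n3
  have pV := bd_phiW h.ker hC o hk.le
  have pU := bd_phiW h.ker hC' o hk.le
  have d1 : alpha κ C o (piM t P) = ∫ w, Wc κ C o w * Wc κ C o w ∂(piM t P) := by
    unfold alpha; simp only [sq]
  have d2 : alpha κ C' o (piM t P) = ∫ w, Wc κ C' o w * Wc κ C' o w ∂(piM t P) := by
    unfold alpha; simp only [sq]
  have j1 := (bV.mul bL).const_mul k
  have j2 := (bU.mul bL).const_mul (-k)
  have j3 := (bV.mul bV).const_mul (k^2/2)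
  have j4 := (bV.mul bU).const_mul (-k^2)
  have j5 := (bU.mul bU).const_mul (k^2/2)
  have bLHS := ((((pU.add j1).add j2).add j3).add j4).add j5
  have mono := integral_mono (bLHS.int (piM t P)) (pV.int (piM t P)) (fun w => by
    have := phi_tangent (x := k * Wc κ C o w) (y := k * Wc κ C' o w)
      (abs_mul_le_one hk.le (abs_Wc_le h.ker hC o w)) ((hle w).trans_lt hk)
    change _ + LL _ * _ + _ ≤ _ at this
    refine le_trans (le_of_eq ?_) this
    ring)
  rw [integral_add (((((pU.add j1).add j2).add j3).add j4).int _) (j5.int _),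
      integral_add ((((pU.add j1).add j2).add j3).int _) (j4.int _),
      integral_add (((pU.add j1).add j2).int _) (j3.int _),
      integral_add ((pU.add j1).int _) (j2.int _), integral_add (pU.int _) (j1.int _)] at mono
  simp only [integral_const_mul] at mono
  rw [n1, n2, n3, ← d1, ← d2] at mono
  linarith

lemma gap_le (h : BMS κ l P) (hC : IsCode C) {C' : Finset (ι → ℝ)} (hC' : IsCode C') (hs : C ⊆ C')
    (t : ι → unitInterval) (o : ι) {k : ℝ} (hk : |k| ≤ 1) :
    k^2 / 2 * (alpha κ C o (piM t P) - alpha κ C' o (piM t P))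
      ≤ ∫ w, phi (k * Wc κ C o w) ∂(piM t P) - ∫ w, phi (k * Wc κ C' o w) ∂(piM t P) := by
  have hlim : Filter.Tendsto (fun n : ℕ => (n : ℝ) / (n + 1) * k) Filter.atTop (nhds k) := by
    have := (tendsto_natCast_div_add_atTop (1:ℝ)).mul_const k
    simpa using this
  have hlt : ∀ n : ℕ, |(n : ℝ) / (n + 1) * k| < 1 := by
    intro n
    have hn : (0:ℝ) ≤ n := Nat.cast_nonneg n
    rw [abs_mul, abs_of_nonneg (by positivity)]
    have : (n : ℝ) / (n + 1) < 1 := by rw [div_lt_one (by positivity)]; linarith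
    have h0 : 0 ≤ (n : ℝ) / (n + 1) := by positivity
    nlinarith [abs_nonneg k]
  have tl : ∀ {D : Finset (ι → ℝ)} (hD : IsCode D), Filter.Tendsto
      (fun n : ℕ => ∫ w, phi (((n : ℝ) / (n + 1) * k) * Wc κ D o w) ∂(piM t P)) Filter.atTop
      (nhds (∫ w, phi (k * Wc κ D o w) ∂(piM t P))) := by
    intro D hD
    refine tendsto_integral_of_dominated_convergence (fun _ => 1) ?_ (integrable_const _) ?_ ?_
    · exact fun n => (bd_phiW h.ker hD o (hlt n).le).1.aestronglyMeasurable
    · intro n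
      refine Filter.Eventually.of_forall fun w => ?_
      exact abs_phi_le (abs_mul_le_one (hlt n).le (abs_Wc_le h.ker hD o w))
    · refine Filter.Eventually.of_forall fun w => ?_
      exact (continuous_phi.tendsto _).comp (hlim.mul_const _)
  refine le_of_tendsto_of_tendsto' (((hlim.pow 2).div_const 2).mul_const _) ((tl hC).sub (tl hC'))
    fun n => gap_lt h hC hC' hs t o (hlt n)

/-- The EXIT-type integral -/
def JJ (κ : ℝ → ℝ) (l : Measure ℝ) (C : Finset (ι → ℝ)) (o : ι) (μ : Measure (ι → ℝ)) : ℝ :=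
  ∫ s, ∫ w, phi (κ s * Wc κ C o w) ∂μ ∂l

lemma bd_phi2 (h : Ker κ) (hC : IsCode C) (o : ι) :
    Bd (fun q : ℝ × (ι → ℝ) => phi (κ q.1 * Wc κ C o q.2)) :=
  ⟨continuous_phi.measurable.comp ((h.meas.comp measurable_fst).mul
    ((measurable_Wc h C o).comp measurable_snd)), 1,
    fun w => abs_phi_le (abs_mul_le_one (h.bd _) (abs_Wc_le h hC o _))⟩

lemma int_JJ (h : Ker κ) (hC : IsCode C) (o : ι) (μ : Measure (ι → ℝ)) [IsProbabilityMeasure μ] :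
    Integrable (fun s => ∫ w, phi (κ s * Wc κ C o w) ∂μ) l :=
  ((bd_phi2 h hC o).int (l.prod μ)).integral_prod_left

lemma JJ_nonneg (h : Ker κ) (hC : IsCode C) (o : ι) (μ : Measure (ι → ℝ)) :
    0 ≤ JJ κ l C o μ :=
  integral_nonneg fun s => integral_nonneg fun w =>
    phi_nonneg (abs_mul_le_one (h.bd _) (abs_Wc_le h hC o _))

lemma JJ_le (h : Ker κ) (hC : IsCode C) (o : ι) (μ : Measure (ι → ℝ)) [IsProbabilityMeasure μ] :
    JJ κ l C o μ ≤ (∫ s, κ s ^ 2 ∂l) * alpha κ C o μ := by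
  unfold JJ
  rw [← integral_mul_const]
  have bk : Bd (fun s => κ s ^ 2) := ⟨h.meas.pow_const 2, 1, fun s => sq_le_one_of_abs (h.bd s)⟩
  refine integral_mono (int_JJ h hC o μ) ((bk.int l).mul_const _) fun s => ?_
  simp only
  unfold alpha
  rw [← integral_const_mul]
  refine integral_mono ((bd_phiW h hC o (h.bd s)).int μ) ((integrable_sqW h hC o μ).const_mul _)
    fun w => ?_
  have := phi_le_sq (abs_mul_le_one (h.bd s) (abs_Wc_le h hC o w))
  simpa [mul_pow] using this

lemma JJ_gap (h : BMS κ l P) (hC : IsCode C) {C' : Finset (ι → ℝ)} (hC' : IsCode C') (hs : C ⊆ C')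
    (t : ι → unitInterval) (o : ι) :
    (∫ s, κ s ^ 2 ∂l) / 2 * (alpha κ C o (piM t P) - alpha κ C' o (piM t P))
      ≤ JJ κ l C o (piM t P) - JJ κ l C' o (piM t P) := by
  unfold JJ
  rw [← integral_sub (int_JJ h.ker hC o _) (int_JJ h.ker hC' o _), div_mul_eq_mul_div, mul_div_assoc,
    ← integral_mul_const]
  have bk : Bd (fun s => κ s ^ 2) :=
    ⟨h.ker.meas.pow_const 2, 1, fun s => sq_le_one_of_abs (h.ker.bd s)⟩
  refine integral_mono ((bk.int l).mul_const _)
    ((int_JJ h.ker hC o _).sub (int_JJ h.ker hC' o _)) fun s => ?_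
  have := gap_le h hC hC' hs t o (h.ker.bd s)
  simp only
  linarith

lemma point_ineq {CA CB : Finset (ι → ℝ)} {o : ι} {A B : Finset ι} (h : BMS κ l P)
    (L : TwoLook C CA CB o A B) (t : unitInterval) :
    (1 - alpha κ C o (piM (fun _ => 1) P)) * JJ κ l C o (piM (tt o t) P)
      ≤ 9 * (JJ κ l C o (piM (tt o t) P) - JJ κ l CA o (piM (tt o t) P)) := by
  have h1 := two_look h L t
  have h2 := alpha_mono h L.hC o (tt o t)
  have h3 := JJ_gap h L.hC L.hCA L.sA (tt o t) o
  have h4 := JJ_le (l := l) h.ker L.hCA o (piM (tt o t) P)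
  have h5 := JJ_nonneg (l := l) h.ker L.hCA o (piM (tt o t) P)
  have h6 := alpha_nonneg (κ := κ) (C := C) o (piM (fun _ => 1) P)
  have h7 := alpha_nonneg (κ := κ) (C := CA) o (piM (tt o t) P)
  have h8 := alpha_le_one h.ker L.hC o (piM (fun _ => 1) P)
  have h9 := alpha_le_one h.ker L.hCA o (piM (tt o t) P)
  have hq : 0 ≤ ∫ s, κ s ^ 2 ∂l := integral_nonneg fun s => sq_nonneg _
  set M1 := alpha κ C o (piM (fun _ => 1) P)
  set α := alpha κ C o (piM (tt o t) P)
  set a := alpha κ CA o (piM (tt o t) P)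
  set JC := JJ κ l C o (piM (tt o t) P)
  set JA := JJ κ l CA o (piM (tt o t) P)
  set q := ∫ s, κ s ^ 2 ∂l
  have hα : a ≤ α := by nlinarith
  have g0 : 0 ≤ JC - JA := le_trans (mul_nonneg (by linarith) (by linarith)) h3
  have e1 : (1 - M1) * JA ≤ (1 - a) * (q * a) :=
    mul_le_mul (by linarith) h4 h5 (by linarith)
  have e2 : (1 - a) * (q * a) ≤ 4 * q * (α - a) := by nlinarith
  have e3 : (1 - M1) * (JC - JA) ≤ 1 * (JC - JA) := mul_le_mul_of_nonneg_right (by linarith) g0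
  nlinarith

end
end RMP

open MeasureTheory ProbabilityTheory
set_option linter.unusedSectionVars false
set_option linter.unusedVariables false
namespace RMP
noncomputable section
variable {ι : Type*} [Fintype ι] [DecidableEq ι]
variable {κ : ℝ → ℝ} {C : Finset (ι → ℝ)}
variable {l P : Measure ℝ} [IsProbabilityMeasure l] [IsProbabilityMeasure P]

/-- x log x -/
def xl (x : ℝ) : ℝ := x * Real.log x

lemma continuous_xl : Continuous xl := Real.continuous_mul_log

lemma xl_mul (p u : ℝ) : xl (p * u) = xl p * u + p * xl u := by
  unfold xl
  rcases eq_or_ne p 0 with rfl | hp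
  · simp
  rcases eq_or_ne u 0 with rfl | hu
  · simp
  rw [Real.log_mul hp hu]; ring

lemma xl_bdd (B : ℝ) : ∃ c, ∀ x, 0 ≤ x → x ≤ B → |xl x| ≤ c := by
  obtain ⟨c, hc⟩ := (isCompact_Icc (a := (0:ℝ)) (b := B)).exists_bound_of_continuousOn
    continuous_xl.continuousOn
  exact ⟨c, fun x h0 h1 => hc x ⟨h0, h1⟩⟩

lemma bd_xlpc (h : Ker κ) (hC : IsCode C) : Bd (fun w => xl (pc κ C w)) := by
  obtain ⟨c, hc⟩ := xl_bdd (2 ^ Fintype.card ι)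
  exact ⟨continuous_xl.measurable.comp (measurable_pc h C), c,
    fun w => hc _ (pc_nonneg h hC w) (pc_le h hC w)⟩

lemma pc_update (h : Ker κ) (hC : IsCode C) (j : ι) (w : ι → ℝ) (hw : w j = 0) (s : ℝ) :
    pc κ C (Function.update w j s) = pc κ C w * (1 + κ s * Wc κ C j w) := by
  have e : pc κ C (Function.update w j s) = pc κ C w + κ s * nc κ C j w := by
    unfold pc nc
    rw [← mul_div_assoc, ← add_div]
    congr 1
    rw [Finset.mul_sum, ← Finset.sum_add_distrib]
    refine Finset.sum_congr rfl fun x _ => ?_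
    rw [← Finset.mul_prod_erase _ _ (Finset.mem_univ j),
      ← Finset.mul_prod_erase _ (fun i => 1 + x i * κ (w i)) (Finset.mem_univ j)]
    have : ∏ i ∈ Finset.univ.erase j, (1 + x i * κ (Function.update w j s i))
        = ∏ i ∈ Finset.univ.erase j, (1 + x i * κ (w i)) :=
      Finset.prod_congr rfl fun i hi => by rw [Function.update_of_ne (Finset.ne_of_mem_erase hi)]
    rw [this, Function.update_self, hw, h.zero]
    ring
  rw [e, ← pc_mul_Wc h hC]; ring

lemma int_neg (hl : l.map Neg.neg = l) (F : ℝ → ℝ) (hF : Measurable F) :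
    ∫ s, F (-s) ∂l = ∫ s, F s ∂l := by
  conv_rhs => rw [← hl]
  rw [integral_map measurable_neg.aemeasurable hF.aestronglyMeasurable]

lemma inner_xl (h : BMS κ l P) (p u : ℝ) (hu : |u| ≤ 1) :
    ∫ s, xl (p * (1 + κ s * u)) ∂l = xl p + p * ∫ s, phi (κ s * u) ∂l := by
  obtain ⟨c, hc⟩ := xl_bdd 2
  have hku : ∀ s, |κ s * u| ≤ 1 := fun s => abs_mul_le_one (h.ker.bd s) hu
  have b1 : Bd (fun s => κ s) := ⟨h.ker.meas, 1, h.ker.bd⟩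
  have m : Measurable (fun s => κ s * u) := h.ker.meas.mul_const u
  have b2 : Bd (fun s => xl (1 + κ s * u)) :=
    ⟨continuous_xl.measurable.comp (m.const_add 1), c, fun s => by
      have := abs_le.1 (hku s); exact hc _ (by linarith) (by linarith)⟩
  have b2' : Bd (fun s => xl (1 - κ s * u)) :=
    ⟨continuous_xl.measurable.comp (m.const_sub 1), c, fun s => by
      have := abs_le.1 (hku s); exact hc _ (by linarith) (by linarith)⟩
  have k0 : ∫ s, κ s ∂l = 0 := by
    have := int_neg h.symm κ h.ker.meas
    simp only [h.ker.odd, integral_neg] at this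
    linarith
  have sy : ∫ s, xl (1 - κ s * u) ∂l = ∫ s, xl (1 + κ s * u) ∂l := by
    have := int_neg h.symm _ b2.1
    rw [← this]
    simp only [h.ker.odd, neg_mul, ← sub_eq_add_neg]
  have ph : ∫ s, phi (κ s * u) ∂l = ∫ s, xl (1 + κ s * u) ∂l := by
    have : ∀ s, phi (κ s * u) = (xl (1 + κ s * u) + xl (1 - κ s * u)) / 2 := fun s => rfl
    simp only [this]
    rw [integral_div, integral_add (b2.int l) (b2'.int l), sy]; ring
  rw [ph]
  have e : ∀ s, xl (p * (1 + κ s * u)) = xl p + (xl p * u) * κ s + p * xl (1 + κ s * u) := by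
    intro s; rw [xl_mul]; ring
  simp only [e]
  have b0 : Bd (fun _ : ℝ => xl p) := ⟨measurable_const, |xl p|, fun _ => le_rfl⟩
  rw [integral_add ((b0.add (b1.const_mul _)).int l) ((b2.const_mul p).int l),
    integral_add (b0.int l) ((b1.const_mul _).int l), integral_const_mul,
    integral_const_mul, k0]
  simp

/-- entropy functional -/
def FF (κ : ℝ → ℝ) (C : Finset (ι → ℝ)) (l : Measure ℝ) [IsProbabilityMeasure l]
    (t : ι → unitInterval) : ℝ := ∫ w, xl (pc κ C w) ∂(piM t l)

lemma FF_step (h : BMS κ l P) (hC : IsCode C) (t : ι → unitInterval) (j : ι) :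
    FF κ C l (Function.update t j 1) - FF κ C l (Function.update t j 0)
      = JJ κ l C j (piM (Function.update t j 0) P) := by
  have b := bd_xlpc h.ker hC
  set t0 := Function.update t j 0 with ht0
  have h0 : t0 j = 0 := by simp [ht0]
  unfold FF
  rw [← mp_integral (piM_update t j l) b.1]
  rw [integral_prod _ ((b.comp (piM_update t j l).measurable).int _)]
  -- a function of w
  set g : (ι → ℝ) → ℝ := fun w => ∫ s, phi (κ s * Wc κ C j w) ∂l with hg
  have b2 := (bd_phi2 h.ker hC j)
  have gm : Measurable g := by
    have : StronglyMeasurable (fun q : (ι → ℝ) × ℝ => phi (κ q.2 * Wc κ C j q.1)) :=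
      (b2.1.comp measurable_swap).stronglyMeasurable
    exact (this.integral_prod_right' (ν := l)).measurable
  have gb : ∀ w, |g w| ≤ 1 := by
    intro w
    have : ‖g w‖ ≤ 1 * l.real Set.univ := norm_integral_le_of_norm_le_const
      (Filter.Eventually.of_forall fun s =>
        abs_phi_le (abs_mul_le_one (h.ker.bd s) (abs_Wc_le h.ker hC j w)))
    simpa using this
  have bg : Bd g := ⟨gm, 1, gb⟩
  have bp : Bd (pc κ C) := ⟨measurable_pc h.ker C, 2 ^ Fintype.card ι, fun w => by
    rw [abs_of_nonneg (pc_nonneg h.ker hC w)]; exact pc_le h.ker hC w⟩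
  have e1 : ∫ w, ∫ s, xl (pc κ C (Function.update w j s)) ∂l ∂(piM t0 l)
      = ∫ w, (xl (pc κ C w) + pc κ C w * g w) ∂(piM t0 l) := by
    refine integral_congr_ae ?_
    filter_upwards [piM_zero_ae t0 j h0 l] with w hw
    simp only [pc_update h.ker hC j w hw]
    exact inner_xl h _ _ (abs_Wc_le h.ker hC j w)
  change ∫ w, ∫ s, xl (pc κ C (Function.update w j s)) ∂l ∂(piM t0 l) - _ = _
  rw [e1, integral_add (b.int _) ((bp.mul bg).int _), add_sub_cancel_left,
    N0 h hC t0 g gm (bg.int _)]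
  · unfold JJ
    rw [hg]
    exact (integral_integral_swap (b2.int (l.prod (piM t0 P)))).symm
  · intro x hx w
    simp only [hg, Wc_flip h.ker hC j hx]
    rcases (hC.sign x hx) j with e | e <;> rw [e]
    · simp
    · congr 1; funext s
      rw [← phi_neg]; congr 1; ring

/-- polynomial version -/
def DD (κ : ℝ → ℝ) (C : Finset (ι → ℝ)) (l : Measure ℝ) (S : Finset ι) : ℝ :=
  ∫ w, xl (pc κ C (mask S w)) ∂(Measure.pi fun _ => l)

def GG (κ : ℝ → ℝ) (C : Finset (ι → ℝ)) (l : Measure ℝ) (x : ℝ) : ℝ :=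
  ∑ S, pw (fun _ => x) S * DD κ C l S

lemma FF_eq (h : Ker κ) (hC : IsCode C) (t : ι → unitInterval) :
    FF κ C l t = ∑ S, pw (fun i => (t i : ℝ)) S * DD κ C l S := by
  obtain ⟨c, hc⟩ := (bd_xlpc h hC).2
  exact integral_expand t l _ (bd_xlpc h hC).1 c hc

lemma pw_eq (t : ι → ℝ) (S : Finset ι) : pw t S = ∏ i, if i ∈ S then t i else 1 - t i := by
  unfold pw
  rw [← Finset.prod_mul_prod_compl S (fun i => if i ∈ S then t i else 1 - t i)]
  congr 1
  · exact Finset.prod_congr rfl fun i hi => by rw [if_pos hi]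
  · exact Finset.prod_congr rfl fun i hi => by rw [if_neg (Finset.mem_compl.1 hi)]

lemma pw_deriv (S : Finset ι) (x : ℝ) :
    HasDerivAt (fun x : ℝ => pw (fun _ => x) S)
      (∑ j, (pw (Function.update (fun _ => x) j 1) S - pw (Function.update (fun _ => x) j 0) S)) x := by
  simp only [pw_eq]
  have := HasDerivAt.fun_finsetProd (u := Finset.univ) (x := x)
    (f := fun (i : ι) (x : ℝ) => if i ∈ S then x else 1 - x)
    (f' := fun i => if i ∈ S then (1:ℝ) else -1) (fun i _ => by
      by_cases hi : i ∈ S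
      · simp only [hi, if_true]; exact hasDerivAt_id x
      · simp only [hi, if_false]; exact (hasDerivAt_id x).const_sub 1)
  refine this.congr_deriv (Finset.sum_congr rfl fun j _ => ?_)
  rw [← Finset.mul_prod_erase _ _ (Finset.mem_univ j),
    ← Finset.mul_prod_erase Finset.univ (fun i => if i ∈ S then Function.update (fun _ => x) j (0:ℝ) i
      else 1 - Function.update (fun _ => x) j (0:ℝ) i) (Finset.mem_univ j)]
  have e : ∀ y : ℝ, ∏ i ∈ Finset.univ.erase j, (if i ∈ S then Function.update (fun _ => x) j y i
      else 1 - Function.update (fun _ => x) j y i)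
      = ∏ i ∈ Finset.univ.erase j, (if i ∈ S then x else 1 - x) :=
    fun y => Finset.prod_congr rfl fun i hi => by
      rw [Function.update_of_ne (Finset.ne_of_mem_erase hi)]
  rw [e, e, Function.update_self, Function.update_self, smul_eq_mul]
  by_cases hj : j ∈ S <;> simp [hj]

lemma russo (h : BMS κ l P) (hC : IsCode C) (x : unitInterval) :
    HasDerivAt (GG κ C l) (∑ j, JJ κ l C j (piM (tt j x) P)) x := by
  have := HasDerivAt.fun_sum (u := Finset.univ) (x := (x:ℝ))
    (A := fun (S : Finset ι) (x : ℝ) => pw (fun _ => x) S * DD κ C l S)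
    (fun S _ => (pw_deriv S x).mul_const _)
  refine this.congr_deriv ?_
  simp only [Finset.sum_mul]
  rw [Finset.sum_comm]
  refine Finset.sum_congr rfl fun j _ => ?_
  have hs := FF_step h hC (fun _ => x) j
  rw [FF_eq h.ker hC, FF_eq h.ker hC, ← Finset.sum_sub_distrib] at hs
  unfold tt
  rw [← hs]
  refine Finset.sum_congr rfl fun S _ => ?_
  rw [sub_mul]
  have e : ∀ y : unitInterval, (fun i => ((Function.update (fun _ => x) j y i : unitInterval) : ℝ))
      = Function.update (fun _ => (x:ℝ)) j (y:ℝ) := by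
    intro y; funext i
    by_cases hi : i = j
    · subst hi; simp
    · simp [hi]
  rw [e, e]; simp

lemma GG_zero (h : Ker κ) (hC : IsCode C) : GG κ C l 0 = 0 := by
  have e := FF_eq (l := l) h hC (fun _ => 0)
  have e' : GG κ C l 0 = FF κ C l (fun _ => 0) := by rw [e]; simp [GG]
  rw [e', FF]
  have : ∀ᵐ w ∂(piM (fun _ : ι => (0:unitInterval)) l), ∀ j, w j = 0 :=
    ae_all_iff.2 fun j => piM_zero_ae _ j rfl l
  rw [integral_congr_ae (g := fun _ => 0)]
  · simp
  · filter_upwards [this] with w hw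
    have : pc κ C w = 1 := by
      unfold pc
      simp [hw, h.zero, hC.card_pos.ne']
    rw [this]; simp [xl]

lemma GG_one (h : Ker κ) (hC : IsCode C) : GG κ C l 1 = FF κ C l (fun _ => 1) := by
  rw [FF_eq h hC]; simp [GG]

lemma int_logpc (h : BMS κ l P) (hC : IsCode C) (t : ι → unitInterval) :
    Integrable (fun w => Real.log (pc κ C w)) (piM t P) := by
  rw [integrable_piM h]
  obtain ⟨c, hc⟩ := (bd_xlpc h.ker hC).2
  refine integrable_bdd ((measurable_dens h.ker).mul
    (Real.measurable_log.comp (measurable_pc h.ker C))) (C.card * c) fun w => ?_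
  have h1 := dens_le_pc h.ker hC w
  rw [div_le_iff₀ hC.card_pos] at h1
  have h2 := hc w
  simp only [xl] at h2
  rw [abs_mul, abs_of_nonneg (pc_nonneg h.ker hC w)] at h2
  rw [abs_mul, abs_of_nonneg (dens_nonneg h.ker w)]
  calc _ ≤ (pc κ C w * C.card) * |Real.log (pc κ C w)| :=
        mul_le_mul_of_nonneg_right h1 (abs_nonneg _)
    _ = C.card * (pc κ C w * |Real.log (pc κ C w)|) := by ring
    _ ≤ _ := mul_le_mul_of_nonneg_left h2 hC.card_pos.le

lemma FF_log (h : BMS κ l P) (hC : IsCode C) (t : ι → unitInterval) :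
    FF κ C l t = ∫ w, Real.log (pc κ C w) ∂(piM t P) := by
  rw [← N0 h hC t (fun w => Real.log (pc κ C w)) (Real.measurable_log.comp (measurable_pc h.ker C)) (int_logpc h hC t)
    (fun x hx w => by rw [pc_flip h.ker hC hx])]
  rfl

lemma FF_gap (h : BMS κ l P) (hC : IsCode C) {C' : Finset (ι → ℝ)} (hC' : IsCode C') (hs : C ⊆ C')
    (t : ι → unitInterval) :
    FF κ C l t - FF κ C' l t ≤ Real.log C'.card - Real.log C.card := by
  rw [FF_log h hC, FF_log h hC', ← integral_sub (int_logpc h hC t) (int_logpc h hC' t)]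
  have : ∫ w, (Real.log (pc κ C w) - Real.log (pc κ C' w)) ∂(piM t P)
      ≤ ∫ _w, (Real.log C'.card - Real.log C.card) ∂(piM t P) := by
    refine integral_mono_ae ((int_logpc h hC t).sub (int_logpc h hC' t)) (integrable_const _) ?_
    filter_upwards [pc_pos_ae h hC t, pc_pos_ae h hC' t] with w h1 h2
    have key : pc κ C w * C.card ≤ pc κ C' w * C'.card := by
      unfold pc
      rw [div_mul_cancel₀ _ hC.card_pos.ne', div_mul_cancel₀ _ hC'.card_pos.ne']
      exact Finset.sum_le_sum_of_subset_of_nonneg hs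
        fun x hx _ => term_nonneg h.ker (hC'.sign x hx) w
    have := Real.log_le_log (mul_pos h1 hC.card_pos) key
    rw [Real.log_mul h1.ne' hC.card_pos.ne', Real.log_mul h2.ne' hC'.card_pos.ne'] at this
    linarith
  simpa using this

lemma mono_of_deriv {f : ℝ → ℝ} {f' : unitInterval → ℝ} (hf : ∀ x : unitInterval, HasDerivAt f (f' x) x)
    (h0 : ∀ x, 0 ≤ f' x) : f 0 ≤ f 1 := by
  have : MonotoneOn f (Set.Icc 0 1) := by
    refine monotoneOn_of_deriv_nonneg (convex_Icc 0 1)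
      (fun x hx => (hf ⟨x, hx⟩).continuousAt.continuousWithinAt)
      (fun x hx => ?_) (fun x hx => ?_)
    · rw [interior_Icc] at hx
      exact (hf ⟨x, hx.1.le, hx.2.le⟩).differentiableAt.differentiableWithinAt
    · rw [interior_Icc] at hx
      have := (hf ⟨x, hx.1.le, hx.2.le⟩).deriv
      simp only at this
      rw [this]; exact h0 _
  exact this (by simp) (by simp) zero_le_one

lemma isCode_one : IsCode ({1} : Finset (ι → ℝ)) where
  sign := by intro x hx; rw [Finset.mem_singleton] at hx; subst hx; intro i; simp
  one := by simp
  mul := by intro x hx y hy; rw [Finset.mem_singleton] at *; subst hx; subst hy; simp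

lemma FF_one_code (h : BMS κ l P) :
    Fintype.card ι * ∫ s, phi (κ s) ∂l ≤ FF κ ({1} : Finset (ι → ℝ)) l (fun _ => 1) := by
  have hW : ∀ (j : ι) (t : ι → unitInterval),
      JJ κ l ({1} : Finset (ι → ℝ)) j (piM t P) = ∫ s, phi (κ s) ∂l := by
    intro j t
    unfold JJ
    congr 1; funext s
    rw [integral_congr_ae (g := fun _ => phi (κ s))]
    · simp
    · filter_upwards [pc_pos_ae h isCode_one t] with w hw
      have : Wc κ ({1} : Finset (ι → ℝ)) j w = 1 := by
        unfold Wc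
        have : nc κ ({1} : Finset (ι → ℝ)) j w = pc κ {1} w := by simp [nc, pc]
        rw [this, div_self hw.ne']
      rw [this, mul_one]
  have := mono_of_deriv (f := fun x => GG κ ({1} : Finset (ι → ℝ)) l x
      - (Fintype.card ι * ∫ s, phi (κ s) ∂l) * x) (f' := fun _ => 0) (fun x => by
    refine ((russo h isCode_one x).sub ((hasDerivAt_id (x:ℝ)).const_mul _)).congr_deriv ?_
    simp [hW]) (fun _ => le_rfl)
  simp only [GG_zero h.ker isCode_one, GG_one h.ker isCode_one] at this
  linarith

theorem main_ineq {CA CB : Finset (ι → ℝ)} {A B : ι → Finset ι} (h : BMS κ l P)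
    (L : ∀ j, TwoLook C CA CB j (A j) (B j)) (hC : IsCode C) (hCA : IsCode CA) (hs : C ⊆ CA)
    (M : ℝ) (hM0 : 0 ≤ M) (hM : ∀ j, M ≤ 1 - alpha κ C j (piM (fun _ => 1) P)) :
    M * (Fintype.card ι * ∫ s, phi (κ s) ∂l - Real.log C.card)
      ≤ 9 * (Real.log CA.card - Real.log C.card) := by
  have h1 := mono_of_deriv (f := fun x => 9 * (GG κ C l x - GG κ CA l x) - M * GG κ C l x) (fun x =>
    (((russo h hC x).sub (russo h hCA x)).const_mul 9).sub ((russo h hC x).const_mul M)) (fun x => by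
      rw [← Finset.sum_sub_distrib, Finset.mul_sum, Finset.mul_sum, ← Finset.sum_sub_distrib]
      refine Finset.sum_nonneg fun j _ => ?_
      have := point_ineq h (L j) x
      have := mul_le_mul_of_nonneg_right (hM j) (JJ_nonneg (l := l) h.ker hC j (piM (tt j x) P))
      linarith)
  simp only [GG_zero h.ker hC, GG_zero h.ker hCA, GG_one h.ker hC, GG_one h.ker hCA] at h1
  have h2 := FF_gap h hC hCA hs (fun _ => 1)
  have h3 := FF_gap h isCode_one hC (by simpa using hC.one) (fun _ => 1)
  have h4 := FF_one_code (ι := ι) h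
  simp only [Finset.card_singleton, Nat.cast_one, Real.log_one, sub_zero] at h3
  have : M * (Fintype.card ι * ∫ s, phi (κ s) ∂l - Real.log C.card) ≤ M * FF κ C l (fun _ => 1) :=
    mul_le_mul_of_nonneg_left (by linarith) hM0
  linarith

end
end RMP

open MeasureTheory ProbabilityTheory
set_option linter.unusedSectionVars false
set_option linter.unusedVariables false
namespace RMP
noncomputable section

section poly
variable {m : ℕ}

/-- monomials -/
def mon (S : Finset (Fin m)) : (Fin m → ZMod 2) → ZMod 2 := fun v => ∏ j ∈ S, v j

/-- admissible monomials -/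
def adm (wt : Fin m → ℕ) (r : ℕ) : Finset (Finset (Fin m)) :=
  Finset.univ.filter fun S => ∑ j ∈ S, wt j ≤ r

/-- weighted Reed-Muller space -/
def RMs (wt : Fin m → ℕ) (r : ℕ) : Submodule (ZMod 2) ((Fin m → ZMod 2) → ZMod 2) :=
  Submodule.span (ZMod 2) (mon '' (adm wt r : Set (Finset (Fin m))))

lemma mon_mem {wt : Fin m → ℕ} {r : ℕ} {S : Finset (Fin m)} (h : ∑ j ∈ S, wt j ≤ r) :
    mon S ∈ RMs wt r :=
  Submodule.subset_span ⟨S, by simp [adm, h], rfl⟩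

lemma zmod2_sq (a : ZMod 2) : a * a = a := by revert a; decide

lemma mon_mul (S T : Finset (Fin m)) : mon S * mon T = mon (S ∪ T) := by
  funext v
  simp only [Pi.mul_apply, mon]
  rw [← Finset.prod_union_inter, ← Finset.prod_sdiff (Finset.inter_subset_left.trans
    (Finset.subset_union_left) : S ∩ T ⊆ S ∪ T), mul_assoc, ← Finset.prod_mul_distrib]
  simp only [zmod2_sq]

lemma RMs_mul {wt : Fin m → ℕ} {a b : ℕ} {f g : (Fin m → ZMod 2) → ZMod 2}
    (hf : f ∈ RMs wt a) (hg : g ∈ RMs wt b) : f * g ∈ RMs wt (a + b) := by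
  have h := Submodule.mul_mem_mul hf hg
  unfold RMs at h
  rw [Submodule.span_mul_span] at h
  refine Submodule.span_le.2 ?_ h
  rintro _ ⟨_, ⟨S, hS, rfl⟩, _, ⟨T, hT, rfl⟩, rfl⟩
  simp only [mon_mul]
  simp [adm] at hS hT
  refine mon_mem ?_
  have := Finset.sum_union_inter (s₁ := S) (s₂ := T) (f := wt)
  omega

lemma RMs_mono {wt : Fin m → ℕ} {a b : ℕ} (h : a ≤ b) : RMs wt a ≤ RMs wt b := by
  refine Submodule.span_mono (Set.image_mono fun S hS => ?_)
  simp [adm] at hS ⊢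
  omega

lemma RMs_wt {wt wt' : Fin m → ℕ} {a : ℕ} (h : ∀ j, wt' j ≤ wt j) : RMs wt a ≤ RMs wt' a := by
  refine Submodule.span_mono (Set.image_mono fun S hS => ?_)
  simp [adm] at hS ⊢
  exact (Finset.sum_le_sum fun j _ => h j).trans hS

lemma RMs_const {wt : Fin m → ℕ} {a : ℕ} (c : ZMod 2) : (fun _ => c) ∈ RMs wt a := by
  have h : mon (∅ : Finset (Fin m)) ∈ RMs wt a := mon_mem (by simp)
  have := (RMs wt a).smul_mem c h
  convert this using 1
  funext v; simp [mon]

lemma RMs_coord (wt : Fin m → ℕ) (j : Fin m) : (fun v => v j) ∈ RMs wt (wt j) := by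
  have h : mon {j} ∈ RMs wt (wt j) := mon_mem (by simp)
  convert h using 1
  funext v; simp [mon]

lemma RMs_comp {wt wt' : Fin m → ℕ} {r : ℕ} (τ : (Fin m → ZMod 2) → (Fin m → ZMod 2))
    (hτ : ∀ j, (fun v => τ v j) ∈ RMs wt' (wt j)) {f : (Fin m → ZMod 2) → ZMod 2}
    (hf : f ∈ RMs wt r) : f ∘ τ ∈ RMs wt' r := by
  have hprod : ∀ S : Finset (Fin m), (mon S ∘ τ) ∈ RMs wt' (∑ j ∈ S, wt j) := by
    intro S
    induction S using Finset.induction_on with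
    | empty => simpa [mon, Function.comp_def] using RMs_const (wt := wt') (a := 0) 1
    | insert j S hj ih =>
      rw [Finset.sum_insert hj]
      have := RMs_mul (hτ j) ih
      convert this using 1
      funext v; simp [mon, Finset.prod_insert hj]
  unfold RMs at hf
  induction hf using Submodule.span_induction with
  | mem x hx =>
    obtain ⟨S, hS, rfl⟩ := hx
    simp [adm] at hS
    exact RMs_mono hS (hprod S)
  | zero => exact (RMs wt' r).zero_mem
  | add x y _ _ hx hy => exact (RMs wt' r).add_mem hx hy
  | smul a x _ hx => exact (RMs wt' r).smul_mem a hx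

/-- weight vanishing at z -/
def wz (z : Fin m) : Fin m → ℕ := fun j => if j = z then 0 else 1

lemma zmod2_add_self (a : ZMod 2) : a + a = 0 := by revert a; decide
lemma zmod2_ne {a : ZMod 2} (h : a ≠ 0) : a = 1 := by revert a; decide

/-- separating functional -/
lemma exists_lam {wt : Fin m → ℕ} (hwt : ∀ j, wt j ≤ 1) {u u' : Fin m → ZMod 2} (hu : u ≠ 0) (hu' : u' ≠ 0) :
    ∃ lam : (Fin m → ZMod 2) → ZMod 2, lam ∈ RMs wt 1 ∧ (∀ a b, lam (a + b) = lam a + lam b)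
      ∧ lam u = 1 ∧ lam u' = 1 := by
  obtain ⟨i, hi⟩ := Function.ne_iff.1 hu
  obtain ⟨k, hk⟩ := Function.ne_iff.1 hu'
  have hi := zmod2_ne hi
  have hk := zmod2_ne hk
  have c : ∀ j, (fun v : Fin m → ZMod 2 => v j) ∈ RMs wt 1 := fun j => RMs_mono (hwt j) (RMs_coord wt j)
  by_cases h1 : u' i = 0
  · by_cases h2 : u k = 0
    · refine ⟨fun v => v i + v k, (RMs wt 1).add_mem (c i) (c k), fun a b => ?_, ?_, ?_⟩
      · simp only [Pi.add_apply]; ring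
      · simp [hi, h2]
      · simp [hk, h1]
    · exact ⟨fun v => v k, c k, fun a b => rfl, zmod2_ne h2, hk⟩
  · exact ⟨fun v => v i, c i, fun a b => rfl, hi, zmod2_ne h1⟩

lemma exists_trans (z : Fin m) {o j k : Fin m → ZMod 2} (hj : j ≠ o) (hk : k ≠ o)
    (hjz : j z = o z) (hkz : k z = o z) :
    ∃ τ : (Fin m → ZMod 2) → (Fin m → ZMod 2), Function.Involutive τ ∧ τ o = o ∧ τ j = k ∧
      (∀ v, τ v z = v z) ∧ ∀ i, (fun v => τ v i) ∈ RMs (wz z) (wz z i) := by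
  have self : ∀ a : Fin m → ZMod 2, a + a = 0 := fun a => funext fun i => zmod2_add_self _
  have ne : ∀ a b : Fin m → ZMod 2, a ≠ b → a + b ≠ 0 := fun a b h e => h (by
    have : a + b + b = b := by rw [e, zero_add]
    rwa [add_assoc, self, add_zero] at this)
  obtain ⟨lam, h1, h2, h3, h4⟩ := exists_lam (wt := wz z)
    (fun i => by unfold wz; split_ifs <;> omega) (ne j o hj) (ne k o hk)
  have h0 : lam 0 = 0 := by have := h2 0 0; simpa using this
  have hd : lam (j + k) = 0 := by
    have e : j + k = (j + o) + (k + o) := by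
      have := self o
      calc j + k = j + k + (o + o) := by rw [this, add_zero]
        _ = _ := by abel
    rw [e, h2, h3, h4]; decide
  have hsm : ∀ c : ZMod 2, lam (c • (j + k)) = 0 := by
    intro c
    rcases eq_or_ne c 0 with rfl | hc
    · simp [h0]
    · rw [zmod2_ne hc, one_smul, hd]
  refine ⟨fun v => v + lam (v + o) • (j + k), ?_, ?_, ?_, ?_, ?_⟩
  · intro v
    simp only
    have : lam (v + lam (v + o) • (j + k) + o) = lam (v + o) := by
      rw [add_right_comm, h2, hsm, add_zero]
    rw [this, add_assoc, self, add_zero]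
  · simp [self, h0]
  · simp only [h3, one_smul]
    rw [← add_assoc, self, zero_add]
  · intro v
    simp [hjz, hkz, zmod2_add_self]
  · intro i
    by_cases hi : i = z
    · subst hi
      have : (fun v : Fin m → ZMod 2 => (v + lam (v + o) • (j + k)) i) = fun v => v i := by
        funext v; simp [hjz, hkz, zmod2_add_self]
      rw [this]; exact RMs_coord _ _
    · have hw : wz z i = 1 := by simp [wz, hi]
      have e : (fun v : Fin m → ZMod 2 => (v + lam (v + o) • (j + k)) i)
          = (fun v => v i) + (j + k) i • (lam + fun _ => lam o) := by
        funext v; simp [h2]; ring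
      rw [e]
      refine (RMs _ _).add_mem (RMs_coord _ _) ((RMs _ _).smul_mem _ ((RMs _ _).add_mem ?_ (RMs_const _)))
      rw [hw]; exact h1

lemma finrank_RMs_le (r : ℕ) : Module.finrank (ZMod 2) (RMs (fun _ : Fin m => 1) r)
    ≤ ∑ i ∈ Finset.range (r + 1), m.choose i := by
  classical
  have h1 : Module.finrank (ZMod 2) (RMs (fun _ : Fin m => 1) r) ≤ (adm (fun _ : Fin m => 1) r).card := by
    unfold RMs
    rw [← Finset.coe_image]
    exact (finrank_span_finset_le_card _).trans Finset.card_image_le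
  refine h1.trans ?_
  have : adm (fun _ : Fin m => 1) r ⊆ (Finset.range (r+1)).biUnion
      fun i => Finset.powersetCard i (Finset.univ : Finset (Fin m)) := by
    intro S hS
    simp [adm] at hS
    simp; omega
  refine (Finset.card_le_card this).trans (Finset.card_biUnion_le.trans ?_)
  simp

lemma finrank_RMs_wz (z : Fin m) (r : ℕ) : Module.finrank (ZMod 2) (RMs (wz z) r)
    ≤ Module.finrank (ZMod 2) (RMs (fun _ : Fin m => 1) r) + (m - 1).choose r := by
  classical
  set T : Finset (Finset (Fin m)) := Finset.univ.filter fun S => z ∈ S ∧ S.card = r + 1 with hT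
  have hle : RMs (wz z) r ≤ RMs (fun _ => 1) r ⊔ Submodule.span (ZMod 2) (T.image mon : Finset _) := by
    refine Submodule.span_le.2 ?_
    rintro _ ⟨S, hS, rfl⟩
    simp [adm] at hS
    have hc : ∑ j ∈ S, wz z j = (S.erase z).card := by
      unfold wz
      rw [Finset.sum_ite]; simp [Finset.filter_ne']
    rw [hc] at hS
    by_cases h : S.card ≤ r
    · exact Submodule.mem_sup_left (mon_mem (by simpa using h))
    · refine Submodule.mem_sup_right (Submodule.subset_span ?_)
      have hz : z ∈ S := by
        by_contra hz; rw [Finset.erase_eq_of_notMem hz] at hS; exact h hS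
      rw [Finset.card_erase_of_mem hz] at hS
      have : S.card = r + 1 := by omega
      simp only [Finset.coe_image]
      exact ⟨S, by simp [hT, hz, this], rfl⟩
  have hTc : T.card ≤ (m - 1).choose r := by
    have : (Finset.powersetCard r (Finset.univ.erase z : Finset (Fin m))).card = (m-1).choose r := by
      rw [Finset.card_powersetCard, Finset.card_erase_of_mem (Finset.mem_univ _)]; simp
    rw [← this]
    refine Finset.card_le_card_of_injOn (fun S => S.erase z) ?_ ?_
    · intro S hS
      simp [hT] at hS
      rw [Finset.mem_coe, Finset.mem_powersetCard]
      refine ⟨Finset.erase_subset_erase _ (Finset.subset_univ _), ?_⟩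
      rw [Finset.card_erase_of_mem hS.1]; omega
    · intro S hS S' hS' e
      simp [hT] at hS hS'
      simp only at e
      rw [← Finset.insert_erase hS.1, e, Finset.insert_erase hS'.1]
  refine (Submodule.finrank_mono hle).trans ((Submodule.finrank_add_le_finrank_add_finrank _ _).trans ?_)
  gcongr
  exact (finrank_span_finset_le_card _).trans (Finset.card_image_le.trans hTc)

end poly

end
end RMP

open MeasureTheory ProbabilityTheory
set_option linter.unusedSectionVars false
set_option linter.unusedVariables false
namespace RMP
noncomputable section
variable {m : ℕ} {ι : Type*} [Fintype ι] [DecidableEq ι] (e : ι ≃ (Fin m → ZMod 2))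

/-- sign of a bit -/
def sg (a : ZMod 2) : ℝ := (-1 : ℝ) ^ a.val

lemma sg_zero : sg 0 = 1 := by simp [sg]
lemma sg_one : sg 1 = -1 := by
  have : (1 : ZMod 2).val = 1 := rfl
  simp [sg, this]
lemma zmod2_cases (a : ZMod 2) : a = 0 ∨ a = 1 := by revert a; decide
lemma sg_add (a b : ZMod 2) : sg (a + b) = sg a * sg b := by
  have h : (1 : ZMod 2) + 1 = 0 := by decide
  rcases zmod2_cases a with rfl | rfl <;> rcases zmod2_cases b with rfl | rfl <;>
    simp [sg_zero, sg_one, h]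
lemma sg_inj {a b : ZMod 2} (h : sg a = sg b) : a = b := by
  rcases zmod2_cases a with rfl | rfl <;> rcases zmod2_cases b with rfl | rfl <;>
    simp [sg_zero, sg_one] at h ⊢ <;> norm_num at h

/-- sign vector -/
def sv (f : (Fin m → ZMod 2) → ZMod 2) : ι → ℝ := fun i => sg (f (e i))

open Classical in
/-- bpsk code -/
def codeF (wt : Fin m → ℕ) (r : ℕ) : Finset (ι → ℝ) :=
  (Finset.univ.filter fun f => f ∈ RMs wt r).image (sv e)

variable {e}
lemma mem_codeF {wt : Fin m → ℕ} {r : ℕ} {x : ι → ℝ} :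
    x ∈ codeF e wt r ↔ ∃ f ∈ RMs wt r, sv e f = x := by
  simp [codeF]

lemma sv_inj : Function.Injective (sv e) := by
  intro f g h
  funext v
  have := congrFun h (e.symm v)
  simp only [sv, Equiv.apply_symm_apply] at this
  exact sg_inj this

lemma card_codeF (wt : Fin m → ℕ) (r : ℕ) :
    (codeF e wt r).card = 2 ^ Module.finrank (ZMod 2) (RMs wt r) := by
  classical
  unfold codeF
  rw [Finset.card_image_of_injective _ sv_inj]
  have := Module.natCard_eq_pow_finrank (K := ZMod 2) (V := RMs wt r)
  rw [Nat.card_zmod] at this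
  rw [← this, Nat.card_eq_fintype_card, Fintype.card_subtype]

lemma isCode_codeF (wt : Fin m → ℕ) (r : ℕ) : IsCode (codeF e wt r) where
  sign := by
    intro x hx i
    obtain ⟨f, hf, rfl⟩ := mem_codeF.1 hx
    rcases zmod2_cases (f (e i)) with h | h <;> simp [sv, h, sg_zero, sg_one]
  one := mem_codeF.2 ⟨0, (RMs wt r).zero_mem, by funext i; simp [sv, sg_zero]⟩
  mul := by
    intro x hx y hy
    obtain ⟨f, hf, rfl⟩ := mem_codeF.1 hx
    obtain ⟨g, hg, rfl⟩ := mem_codeF.1 hy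
    exact mem_codeF.2 ⟨f + g, (RMs wt r).add_mem hf hg, by funext i; simp [sv, sg_add]⟩

variable (e)
/-- permutation of indices from an involution of the space -/
def pm {τ : (Fin m → ZMod 2) → (Fin m → ZMod 2)} (h : Function.Involutive τ) : Equiv.Perm ι :=
  (e.trans h.toPerm).trans e.symm

variable {e}
lemma pm_apply {τ : (Fin m → ZMod 2) → (Fin m → ZMod 2)} (h : Function.Involutive τ) (i : ι) :
    e (pm e h i) = τ (e i) := by simp [pm]

lemma code_inv {wt wt' : Fin m → ℕ} {r : ℕ} {τ : (Fin m → ZMod 2) → (Fin m → ZMod 2)}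
    (h : Function.Involutive τ)
    (h1 : ∀ j, (fun v => τ v j) ∈ RMs wt' (wt j)) (h2 : ∀ j, (fun v => τ v j) ∈ RMs wt (wt' j))
    (x : ι → ℝ) : x ∈ codeF e wt r ↔ x ∘ (pm e h) ∈ codeF e wt' r := by
  constructor
  · intro hx
    obtain ⟨f, hf, rfl⟩ := mem_codeF.1 hx
    exact mem_codeF.2 ⟨f ∘ τ, RMs_comp τ h1 hf, by
      funext i; simp [sv, pm_apply]⟩
  · intro hx
    obtain ⟨f, hf, hfx⟩ := mem_codeF.1 hx
    refine mem_codeF.2 ⟨f ∘ τ, RMs_comp τ h2 hf, ?_⟩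
    funext i
    have := congrFun hfx (pm e h i)
    simp only [sv, Function.comp_apply, pm_apply] at this ⊢
    rw [this]
    congr 1
    apply e.injective
    rw [pm_apply, pm_apply, h]

lemma code_trans (r : ℕ) (i j : ι) : ∃ σ : Equiv.Perm ι, σ i = j ∧
    ∀ x, x ∈ codeF e (fun _ => 1) r ↔ x ∘ σ ∈ codeF e (fun _ => 1) r := by
  have self : ∀ a : Fin m → ZMod 2, a + a = 0 := fun a => funext fun i => zmod2_add_self _
  have h : Function.Involutive (fun v : Fin m → ZMod 2 => v + (e i + e j)) := by
    intro v; simp only; rw [add_assoc, self, add_zero]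
  have hm : ∀ k, (fun v : Fin m → ZMod 2 => (v + (e i + e j)) k) ∈ RMs (fun _ => 1) 1 := fun k =>
    (RMs _ _).add_mem (RMs_coord (fun _ => 1) k) (RMs_const _)
  refine ⟨pm e h, ?_, code_inv h hm hm⟩
  apply e.injective
  rw [pm_apply, ← add_assoc, self, zero_add]

variable (e)
/-- affine half space through o -/
def half (z : Fin m) (o : ι) : Finset ι := Finset.univ.filter fun i => e i z = e o z

variable {e}
lemma mem_half {z : Fin m} {o i : ι} : i ∈ half e z o ↔ e i z = e o z := by simp [half]

lemma split_half (z : Fin m) (r : ℕ) (o : ι) (x : ι → ℝ) (hx : x ∈ codeF e (wz z) r) :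
    (half e z o).piecewise x 1 ∈ codeF e (wz z) r := by
  obtain ⟨f, hf, rfl⟩ := mem_codeF.1 hx
  have hw : wz z z = 0 := by simp [wz]
  have c := RMs_coord (wz z) z
  rw [hw] at c
  have hi : ((fun v => v z) + fun _ => e o z + 1) ∈ RMs (wz z) 0 :=
    (RMs _ _).add_mem c (RMs_const _)
  have hfi := RMs_mul hf hi
  rw [add_zero] at hfi
  set g : (Fin m → ZMod 2) → ZMod 2 := (fun v => v z) + fun _ => e o z + 1 with hg
  refine mem_codeF.2 ⟨f * g, hfi, ?_⟩
  have hgi : ∀ i, g (e i) = e i z + (e o z + 1) := fun i => rfl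
  funext i
  by_cases h : e i z = e o z
  · rw [Finset.piecewise_eq_of_mem _ _ _ (mem_half.2 h)]
    have : e i z + (e o z + 1) = 1 := by rw [h, ← add_assoc, zmod2_add_self, zero_add]
    simp only [sv, Pi.mul_apply, hgi, this, mul_one]
  · rw [Finset.piecewise_eq_of_notMem _ _ _ (fun h' => h (mem_half.1 h'))]
    have : e i z + (e o z + 1) = 0 := by
      have : ∀ a b : ZMod 2, a ≠ b → a + (b + 1) = 0 := by decide
      exact this _ _ h
    simp only [sv, Pi.mul_apply, hgi, this, mul_zero, sg_zero, Pi.one_apply]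

lemma sym_half (z : Fin m) (r : ℕ) (o : ι) (j : ι) (hj : j ∈ (half e z o).erase o) (k : ι)
    (hk : k ∈ (half e z o).erase o) : ∃ σ ∈ stab (codeF e (wz z) r) o (half e z o), σ j = k := by
  rw [Finset.mem_erase, mem_half] at hj hk
  obtain ⟨τ, h1, h2, h3, h4, h5⟩ := exists_trans z (o := e o) (j := e j) (k := e k)
    (fun h => hj.1 (e.injective h)) (fun h => hk.1 (e.injective h)) hj.2 hk.2
  refine ⟨pm e h1, ⟨?_, code_inv h1 h5 h5, ?_⟩, ?_⟩
  · apply e.injective; rw [pm_apply, h2]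
  · intro i; rw [mem_half, mem_half, pm_apply, h4]
  · apply e.injective; rw [pm_apply, h3]

lemma swap_half (z z' : Fin m) (r : ℕ) (o : ι) : ∃ τ : Equiv.Perm ι, τ o = o ∧
    ∀ x, x ∈ codeF e (wz z) r ↔ x ∘ τ ∈ codeF e (wz z') r := by
  have h : Function.Involutive (fun v : Fin m → ZMod 2 => fun j =>
      v (Equiv.swap z z' j) + (e o j + e o (Equiv.swap z z' j))) := by
    intro v; funext j
    simp only [Equiv.swap_apply_self]
    have : ∀ a b c : ZMod 2, a + (b + c) + (c + b) = a := by decide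
    exact this _ _ _
  have sw : ∀ j, wz z' (Equiv.swap z z' j) = wz z j := by
    intro j
    unfold wz
    have : (Equiv.swap z z' j = z') ↔ j = z := by
      constructor
      · intro h; rw [← Equiv.swap_apply_self z z' j, h]; simp
      · rintro rfl; simp
    simp only [this]
  have sw' : ∀ j, wz z (Equiv.swap z z' j) = wz z' j := by
    intro j
    rw [← sw, Equiv.swap_apply_self]
  refine ⟨pm e h, ?_, code_inv h (fun j => ?_) (fun j => ?_)⟩
  · apply e.injective; rw [pm_apply]; funext j
    have : ∀ a b : ZMod 2, a + (b + a) = b := by decide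
    exact this _ _
  · refine (RMs _ _).add_mem ?_ (RMs_const _)
    rw [← sw]; exact RMs_coord _ _
  · refine (RMs _ _).add_mem ?_ (RMs_const _)
    rw [← sw']; exact RMs_coord _ _

lemma card_half {z z' : Fin m} (hz : z ≠ z') (o : ι) :
    2 * ((half e z o).erase o ∩ (half e z' o).erase o).card ≤ ((half e z o).erase o).card := by
  set D := (half e z o).erase o ∩ (half e z' o).erase o
  set g : ι → ι := fun i => e.symm (e i + Pi.single z' 1) with hg
  have ginj : Function.Injective g := by
    intro a b h
    have := e.symm.injective h
    exact e.injective (add_right_cancel this)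
  have eg : ∀ i k, e (g i) k = e i k + (Pi.single z' (1 : ZMod 2) : Fin m → ZMod 2) k := by
    intro i k; simp [hg]
  have hD : ∀ i ∈ D, i ≠ o ∧ e i z = e o z ∧ e i z' = e o z' := by
    intro i hi
    simp only [D, Finset.mem_inter, Finset.mem_erase, mem_half] at hi
    exact ⟨hi.1.1, hi.1.2, hi.2.2⟩
  have hne : ∀ a : ZMod 2, a + 1 ≠ a := by decide
  have hgz : ∀ i ∈ D, e (g i) z' ≠ e o z' := by
    intro i hi
    rw [eg, (hD i hi).2.2]; simp
  have disj : Disjoint D (D.image g) := by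
    rw [Finset.disjoint_left]
    intro i hi hi'
    obtain ⟨k, hk, rfl⟩ := Finset.mem_image.1 hi'
    exact hgz k hk (hD _ hi).2.2
  have sub : D ∪ D.image g ⊆ (half e z o).erase o := by
    intro i hi
    rcases Finset.mem_union.1 hi with hi | hi
    · exact (Finset.mem_inter.1 hi).1
    · obtain ⟨k, hk, rfl⟩ := Finset.mem_image.1 hi
      rw [Finset.mem_erase, mem_half]
      refine ⟨fun h => hgz k hk (by rw [h]), ?_⟩
      rw [eg, (hD k hk).2.1, Pi.single_eq_of_ne hz, add_zero]
  have := Finset.card_le_card sub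
  rw [Finset.card_union_of_disjoint disj, Finset.card_image_of_injective _ ginj] at this
  omega

lemma codeF_sub (z : Fin m) (r : ℕ) : codeF e (fun _ => 1) r ⊆ codeF e (wz z) r := by
  intro x hx
  obtain ⟨f, hf, rfl⟩ := mem_codeF.1 hx
  exact mem_codeF.2 ⟨f, RMs_wt (fun j => by unfold wz; split_ifs <;> omega) hf, rfl⟩

lemma twoLook {z z' : Fin m} (hz : z ≠ z') (r : ℕ) (o : ι) :
    TwoLook (codeF e (fun _ => 1) r) (codeF e (wz z) r) (codeF e (wz z') r) o
      (half e z o) (half e z' o) where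
  hC := isCode_codeF _ _
  hCA := isCode_codeF _ _
  hCB := isCode_codeF _ _
  sA := codeF_sub z r
  sB := codeF_sub z' r
  oA := mem_half.2 rfl
  oB := mem_half.2 rfl
  splitA := split_half z r o
  splitB := split_half z' r o
  symA := sym_half z r o
  symB := sym_half z' r o
  swap := swap_half z z' r o
  cardA := card_half hz o
  cardB := by rw [Finset.inter_comm]; exact card_half hz.symm o

variable {κ : ℝ → ℝ} {l P : Measure ℝ} [IsProbabilityMeasure l] [IsProbabilityMeasure P]

lemma alpha_const (h : BMS κ l P) (r : ℕ) (i j : ι) :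
    alpha κ (codeF e (fun _ => 1) r) i (piM (fun _ => 1) P)
      = alpha κ (codeF e (fun _ => 1) r) j (piM (fun _ => 1) P) := by
  obtain ⟨σ, hσ, hx⟩ := code_trans (e := e) r i j
  have b := bd_Wc h.ker (isCode_codeF (e := e) (fun _ => 1) r) i
  have := mp_integral (mp_perm (fun _ : ι => mix 1 P) σ) (b.mul b).1
  unfold alpha piM
  simp only [sq]
  rw [← this]
  simp only [Wc_perm σ hx, hσ]

theorem code_ineq (h : BMS κ l P) (hm : 2 ≤ m) (r : ℕ) (i : ι)
    (hpos : 0 ≤ Fintype.card ι * ∫ s, phi (κ s) ∂l - (∑ k ∈ Finset.range (r + 1), (m.choose k : ℝ)) * Real.log 2) :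
    (1 - alpha κ (codeF e (fun _ => 1) r) i (piM (fun _ => 1) P)) *
      (Fintype.card ι * ∫ s, phi (κ s) ∂l - (∑ k ∈ Finset.range (r + 1), (m.choose k : ℝ)) * Real.log 2)
      ≤ 9 * ((m - 1).choose r * Real.log 2) := by
  have hz : (⟨0, by omega⟩ : Fin m) ≠ ⟨1, by omega⟩ := by simp
  have hC := isCode_codeF (e := e) (fun _ => 1) r
  have M0 : 0 ≤ 1 - alpha κ (codeF e (fun _ => 1) r) i (piM (fun _ => 1) P) := by
    have := alpha_le_one h.ker hC i (piM (fun _ => 1) P); linarith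
  have key := main_ineq h (fun j => twoLook (e := e) hz r j) hC (isCode_codeF _ r)
    (codeF_sub _ r) _ M0 (fun j => by rw [alpha_const h r i j])
  rw [card_codeF, card_codeF] at key
  push_cast at key
  rw [Real.log_pow, Real.log_pow] at key
  have l2 : 0 ≤ Real.log 2 := Real.log_nonneg (by norm_num)
  have f1 : (Module.finrank (ZMod 2) (RMs (fun _ : Fin m => 1) r) : ℝ)
      ≤ ∑ k ∈ Finset.range (r + 1), (m.choose k : ℝ) := by exact_mod_cast finrank_RMs_le r
  have f2 : (Module.finrank (ZMod 2) (RMs (wz (⟨0, by omega⟩ : Fin m)) r) : ℝ)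
      ≤ Module.finrank (ZMod 2) (RMs (fun _ : Fin m => 1) r) + (m - 1).choose r := by
    exact_mod_cast finrank_RMs_wz _ r
  have g1 := mul_le_mul_of_nonneg_right f1 l2
  have g2 := mul_le_mul_of_nonneg_right f2 l2
  have g3 := mul_le_mul_of_nonneg_left (sub_le_sub_left g1 (Fintype.card ι * ∫ s, phi (κ s) ∂l)) M0
  linarith

end
end RMP

open MeasureTheory ProbabilityTheory
set_option linter.unusedSectionVars false
set_option linter.unusedVariables false
namespace RMP
noncomputable section

/-- index to point -/
def pt (m : ℕ) : Fin (2 ^ m) ≃ (Fin m → ZMod 2) :=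
  (finFunctionFinEquiv (m := 2) (n := m)).symm

lemma pt_apply (m : ℕ) (i : Fin (2 ^ m)) (j : Fin m) :
    pt m i j = ((((i : ℕ) / 2 ^ (j : ℕ)) % 2 : ℕ) : ZMod 2) := by
  have : (pt m i j).val = (i : ℕ) / 2 ^ (j : ℕ) % 2 := rfl
  rw [← this, ZMod.natCast_zmod_val]

lemma adm_one (m r : ℕ) : adm (fun _ : Fin m => 1) r
    = Finset.univ.filter (fun S : Finset (Fin m) => S.card ≤ r) := by
  unfold adm; simp

lemma bpskRM_eq (r m : ℕ) : bpskRM r m = codeF (pt m) (fun _ => 1) r := by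
  classical
  ext x
  rw [mem_codeF]
  unfold bpskRM bpskImage RMcode RMs
  simp only [Submodule.mem_span_image_finset_iff_exists_fun']
  simp only [Finset.mem_image, Finset.mem_univ, true_and]
  have key : ∀ c : Finset (Fin m) → ZMod 2, bpsk (RMword r m c)
      = sv (pt m) (∑ i ∈ adm (fun _ => 1) r, c i • mon i) := by
    intro c
    funext i
    unfold bpsk RMword sv sg
    rw [adm_one]
    simp [mon, pt_apply]
  constructor
  · rintro ⟨w, ⟨c, rfl⟩, rfl⟩
    exact ⟨_, ⟨c, rfl⟩, (key c).symm⟩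
  · rintro ⟨f, ⟨c, rfl⟩, rfl⟩
    exact ⟨_, ⟨c, rfl⟩, key c⟩

/-- symmetrization -/
def symz (P : Measure ℝ) : Measure ℝ := (2 : ENNReal)⁻¹ • (P + P.map Neg.neg)

instance (P : Measure ℝ) [IsProbabilityMeasure P] : IsProbabilityMeasure (symz P) := by
  constructor
  unfold symz
  have : IsProbabilityMeasure (P.map Neg.neg) :=
    Measure.isProbabilityMeasure_map measurable_neg.aemeasurable
  simp only [Measure.smul_apply, Measure.add_apply, measure_univ, smul_eq_mul]
  rw [one_add_one_eq_two]
  exact ENNReal.inv_mul_cancel (by norm_num) (by norm_num)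

lemma symz_symm (P : Measure ℝ) : (symz P).map Neg.neg = symz P := by
  unfold symz
  rw [Measure.map_smul, Measure.map_add _ _ measurable_neg,
    Measure.map_map measurable_neg measurable_neg]
  have : (Neg.neg ∘ Neg.neg : ℝ → ℝ) = id := by funext x; simp
  rw [this, Measure.map_id, add_comm]

lemma symz_ac (P : Measure ℝ) : P ≪ symz P := by
  intro s hs
  unfold symz at hs
  simp only [Measure.smul_apply, Measure.add_apply, smul_eq_mul, mul_eq_zero, add_eq_zero] at hs
  rcases hs with h | h
  · simp at h
  · exact h.1

lemma lint_neg {l : Measure ℝ} (hl : l.map Neg.neg = l) (F : ℝ → ENNReal) (hF : Measurable F) :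
    ∫⁻ s, F (-s) ∂l = ∫⁻ s, F s ∂l := by
  conv_rhs => rw [← hl]
  rw [lintegral_map hF measurable_neg]

lemma map_wd {l : Measure ℝ} (hl : l.map Neg.neg = l) (g : ℝ → ENNReal) (hg : Measurable g) :
    (l.withDensity g).map Neg.neg = l.withDensity (fun w => g (-w)) := by
  ext s hs
  have hs' : MeasurableSet ((Neg.neg : ℝ → ℝ) ⁻¹' s) := measurable_neg hs
  rw [Measure.map_apply measurable_neg hs, withDensity_apply _ hs', withDensity_apply _ hs,
    ← lintegral_indicator hs', ← lintegral_indicator hs,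
    ← lint_neg hl (s.indicator fun w => g (-w)) ((hg.comp measurable_neg).indicator hs)]
  refine lintegral_congr fun w => ?_
  simp only [Set.indicator, neg_neg]
  rfl

lemma exists_BMS (P : Measure ℝ) [IsProbabilityMeasure P] : ∃ κ, BMS κ (symz P) P := by
  set ν := symz P with hν
  have hs : ν.map Neg.neg = ν := symz_symm P
  set g := P.rnDeriv ν with hgd
  have hg : Measurable g := Measure.measurable_rnDeriv _ _
  have hP : ν.withDensity g = P := Measure.withDensity_rnDeriv_eq _ _ (symz_ac P)
  have h2 : ν.withDensity (fun w => g w + g (-w)) = ν.withDensity (fun _ => 2) := by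
    have e1 : ν.withDensity (fun w => g w + g (-w))
        = ν.withDensity g + ν.withDensity (fun w => g (-w)) := withDensity_add_left hg _
    rw [e1, ← map_wd hs g hg, hP, withDensity_const, hν]
    unfold symz
    rw [smul_smul, ENNReal.mul_inv_cancel (by norm_num) (by norm_num), one_smul]
  have hae : ∀ᵐ w ∂ν, g w + g (-w) = 2 :=
    (withDensity_eq_iff_of_sigmaFinite (hg.add (hg.comp measurable_neg)).aemeasurable
      measurable_const.aemeasurable).1 h2
  let c : ℝ → ℝ := fun w => max (-1) (min 1 ((g w).toReal - 1))
  have hc : Measurable c := measurable_const.max (measurable_const.min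
    (hg.ennreal_toReal.sub measurable_const))
  have hcb : ∀ w, -1 ≤ c w ∧ c w ≤ 1 := fun w =>
    ⟨le_max_left _ _, max_le (by norm_num) (min_le_left _ _)⟩
  refine ⟨fun w => (c w - c (-w)) / 2, ⟨?_, ?_, ?_⟩, hs, ?_⟩
  · exact (hc.sub (hc.comp measurable_neg)).div_const 2
  · intro w; simp only [neg_neg]; ring
  · intro w
    rw [abs_le]
    have h1 := hcb w; have h2 := hcb (-w)
    constructor <;> linarith [h1.1, h1.2, h2.1, h2.2]
  · conv_lhs => rw [← hP]
    refine withDensity_congr_ae ?_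
    filter_upwards [hae] with w hw
    have f1 : g w ≠ ⊤ := by intro h; rw [h] at hw; simp at hw
    have f2 : g (-w) ≠ ⊤ := by intro h; rw [h] at hw; simp at hw
    have hr : (g w).toReal + (g (-w)).toReal = 2 := by
      rw [← ENNReal.toReal_add f1 f2, hw]; simp
    have p1 : 0 ≤ (g w).toReal := ENNReal.toReal_nonneg
    have p2 : 0 ≤ (g (-w)).toReal := ENNReal.toReal_nonneg
    have c1 : c w = (g w).toReal - 1 := by
      simp only [c]; rw [min_eq_right (by linarith), max_eq_right (by linarith)]
    have c2 : c (-w) = (g (-w)).toReal - 1 := by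
      simp only [c]; rw [min_eq_right (by linarith), max_eq_right (by linarith)]
    rw [c1, c2]
    have : 1 + ((g w).toReal - 1 - ((g (-w)).toReal - 1)) / 2 = (g w).toReal := by linarith
    rw [this, ENNReal.ofReal_toReal f1]

end
end RMP

open MeasureTheory ProbabilityTheory
set_option linter.unusedSectionVars false
set_option linter.unusedVariables false
namespace RMP
noncomputable section
variable {κ : ℝ → ℝ} {l P : Measure ℝ} [IsProbabilityMeasure l] [IsProbabilityMeasure P]

instance instSign : IsProbabilityMeasure signMeasure := by
  constructor
  unfold signMeasure
  simp only [Measure.smul_apply, Measure.add_apply, measure_univ, smul_eq_mul]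
  rw [one_add_one_eq_two]
  exact ENNReal.inv_mul_cancel (by norm_num) (by norm_num)

lemma int_sign (G : ℝ → ℝ) : ∫ x, G x ∂signMeasure = (G (-1) + G 1) / 2 := by
  unfold signMeasure
  rw [integral_smul_measure, integral_add_measure, integral_dirac, integral_dirac]
  · simp; ring
  · exact integrable_dirac (by simp)
  · exact integrable_dirac (by simp)

lemma bd_ker (h : Ker κ) : Bd κ := ⟨h.meas, 1, h.bd⟩

lemma int_dens (h : BMS κ l P) {F : ℝ → ℝ} (hF : Bd F) :
    ∫ z, F z ∂P = ∫ z, F z ∂l + ∫ z, κ z * F z ∂l := by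
  have e : ∫ z, F z ∂P = ∫ z, (1 + κ z) * F z ∂l := by
    rw [h.dens, integral_withDensity_eq_integral_toReal_smul]
    · refine integral_congr_ae (Filter.Eventually.of_forall fun z => ?_)
      have := (abs_le.1 (h.ker.bd z)).1
      simp only [smul_eq_mul]
      rw [ENNReal.toReal_ofReal (by linarith)]
    · exact (measurable_const.add h.ker.meas).ennreal_ofReal
    · exact Filter.Eventually.of_forall fun z => ENNReal.ofReal_lt_top
  rw [e, ← integral_add (hF.int l) (((bd_ker h.ker).mul hF).int l)]
  refine integral_congr_ae (Filter.Eventually.of_forall fun z => ?_)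
  simp only []; ring

lemma int_dens_neg (h : BMS κ l P) {F : ℝ → ℝ} (hF : Bd F) :
    ∫ z, F (-z) ∂P = ∫ z, F z ∂l - ∫ z, κ z * F z ∂l := by
  have hF' : Bd fun z => F (-z) := ⟨hF.1.comp measurable_neg, hF.2.imp fun c hc z => hc (-z)⟩
  rw [int_dens h hF', int_neg h.symm F hF.1, ← int_neg h.symm (fun z => κ z * F z)
    (h.ker.meas.mul hF.1)]
  have : ∫ s, κ (-s) * F (-s) ∂l = - ∫ s, κ s * F (-s) ∂l := by
    rw [← integral_neg]
    refine integral_congr_ae (Filter.Eventually.of_forall fun z => ?_)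
    simp only [h.ker.odd]; ring
  rw [this]; ring

lemma meas_Y : Measurable (fun q : ℝ × ℝ => q.1 * q.2) := measurable_fst.mul measurable_snd

lemma int_Q1 (h : BMS κ l P) {G : ℝ → ℝ} (hG : Bd G) :
    ∫ q, G (q.1 * q.2) ∂(signMeasure.prod P) = ∫ z, G z ∂l := by
  rw [integral_prod]
  · rw [int_sign]
    simp only [neg_mul, one_mul]
    rw [int_dens h hG, int_dens_neg h hG]; ring
  · obtain ⟨c, hc⟩ := hG.2
    exact integrable_bdd (hG.1.comp meas_Y) c fun w => hc _

lemma ae_fst : ∀ᵐ q ∂(signMeasure.prod P), |q.1| ≤ 1 := by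
  have h1 : ∀ᵐ x ∂signMeasure, |x| ≤ 1 := by
    unfold signMeasure
    refine Measure.ae_smul_measure ?_ _
    rw [ae_add_measure_iff]
    constructor <;> rw [ae_dirac_iff (measurableSet_le (by fun_prop) (by fun_prop))] <;> simp
  exact Measure.quasiMeasurePreserving_fst.ae h1

lemma integrable_fst_mul {F : ℝ × ℝ → ℝ} (hF : Bd F) :
    Integrable (fun q : ℝ × ℝ => q.1 * F q) (signMeasure.prod P) := by
  obtain ⟨c, hc⟩ := hF.2
  refine Integrable.of_bound (measurable_fst.mul hF.1).aestronglyMeasurable c ?_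
  filter_upwards [ae_fst] with q hq
  rw [Real.norm_eq_abs, abs_mul]
  nlinarith [hc q, abs_nonneg (F q), abs_nonneg q.1]

lemma int_Q2 (h : BMS κ l P) {G : ℝ → ℝ} (hG : Bd G) :
    ∫ q, q.1 * G (q.1 * q.2) ∂(signMeasure.prod P) = ∫ z, κ z * G z ∂l := by
  rw [integral_prod]
  · rw [int_sign]
    simp only [neg_mul, one_mul]
    rw [integral_neg, int_dens h hG, int_dens_neg h hG]; ring
  · exact integrable_fst_mul (F := fun q => G (q.1 * q.2)) ⟨hG.1.comp meas_Y, hG.2.imp fun c hc w => hc _⟩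

lemma bd_ind {F : ℝ → ℝ} (hF : Bd F) {t : Set ℝ} (ht : MeasurableSet t) : Bd (t.indicator F) := by
  obtain ⟨c, hc⟩ := hF.2
  refine ⟨hF.1.indicator ht, c, fun w => ?_⟩
  by_cases hw : w ∈ t
  · rw [Set.indicator_of_mem hw]; exact hc w
  · rw [Set.indicator_of_notMem hw, abs_zero]; exact (abs_nonneg _).trans (hc w)

lemma condMean_eq (h : BMS κ l P) :
    (fun q : ℝ × ℝ => κ (q.1 * q.2)) =ᵐ[signMeasure.prod P]
      condMean (signMeasure.prod P) (fun q : ℝ × ℝ => q.1) (fun q : ℝ × ℝ => q.1 * q.2) := by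
  unfold condMean
  have hk : Bd fun q : ℝ × ℝ => κ (q.1 * q.2) := ⟨h.ker.meas.comp meas_Y, 1, fun w => h.ker.bd _⟩
  refine ae_eq_condExp_of_forall_setIntegral_eq meas_Y.comap_le ?_ ?_ ?_ ?_
  · have := integrable_fst_mul (P := P) (F := fun _ => 1) ⟨measurable_const, 1, by simp⟩
    simpa using this
  · intro s _ _
    exact (hk.int _).integrableOn
  · rintro s ⟨t, ht, rfl⟩ _
    have hs : MeasurableSet ((fun q : ℝ × ℝ => q.1 * q.2) ⁻¹' t) := meas_Y ht
    rw [← integral_indicator hs, ← integral_indicator hs]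
    have b1 : Bd (t.indicator (fun _ => (1:ℝ))) := bd_ind ⟨measurable_const, 1, by simp⟩ ht
    have e1 := int_Q1 h (bd_ind (bd_ker h.ker) ht)
    have e2 := int_Q2 h b1
    have e3 : ∫ z, κ z * t.indicator (fun _ => (1:ℝ)) z ∂l = ∫ z, t.indicator κ z ∂l := by
      congr 1; funext z; by_cases hz : z ∈ t <;> simp [hz]
    have e4 : ((fun q : ℝ × ℝ => q.1 * q.2) ⁻¹' t).indicator (fun q => κ (q.1 * q.2))
        = fun q => t.indicator κ (q.1 * q.2) := by
      funext q; rfl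
    have e5 : ((fun q : ℝ × ℝ => q.1 * q.2) ⁻¹' t).indicator (fun q => q.1)
        = fun q => q.1 * t.indicator (fun _ => (1:ℝ)) (q.1 * q.2) := by
      funext q
      by_cases hq : q.1 * q.2 ∈ t
      · rw [Set.indicator_of_mem hq, Set.indicator_of_mem (show q ∈ (fun q : ℝ × ℝ => q.1 * q.2) ⁻¹' t from hq), mul_one]
      · rw [Set.indicator_of_notMem hq, Set.indicator_of_notMem (show q ∉ (fun q : ℝ × ℝ => q.1 * q.2) ⁻¹' t from hq), mul_zero]
    rw [e4, e5, e1, e2, e3]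
  · exact (h.ker.meas.comp (comap_measurable _)).stronglyMeasurable.aestronglyMeasurable

lemma hb_eq (k : ℝ) (hk : |k| ≤ 1) : hb ((1 + k) / 2) = 1 - phi k / Real.log 2 := by
  have l2 : Real.log 2 ≠ 0 := (Real.log_pos (by norm_num)).ne'
  have key : ∀ x : ℝ, x / 2 * Real.logb 2 (x / 2) = (x * Real.log x / 2) / Real.log 2 - x / 2 := by
    intro x
    by_cases hx : x = 0
    · simp [hx]
    · unfold Real.logb
      rw [Real.log_div hx (by norm_num)]
      field_simp
  unfold hb phi
  have e : 1 - (1 + k) / 2 = (1 - k) / 2 := by ring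
  rw [e, key, key]
  field_simp
  ring

lemma bd_phi (h : Ker κ) : Bd fun z => phi (κ z) := by
  refine ⟨continuous_phi.measurable.comp h.meas, ?_⟩
  obtain ⟨c, hc⟩ := (isCompact_Icc (a := (-1:ℝ)) (b := 1)).exists_bound_of_continuousOn
    continuous_phi.continuousOn
  exact ⟨c, fun z => hc _ ⟨(abs_le.1 (h.bd z)).1, (abs_le.1 (h.bd z)).2⟩⟩

lemma capacity_eq (h : BMS κ l P) : capacity P * Real.log 2 = ∫ z, phi (κ z) ∂l := by
  have l2 : Real.log 2 ≠ 0 := (Real.log_pos (by norm_num)).ne'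
  unfold capacity
  have e1 : ∫ p, hb ((1 + condMean (signMeasure.prod P)
        (fun q : ℝ × ℝ => q.1) (fun q : ℝ × ℝ => q.1 * q.2) p) / 2) ∂(signMeasure.prod P)
      = ∫ p, (fun z => 1 - phi (κ z) / Real.log 2) (p.1 * p.2) ∂(signMeasure.prod P) := by
    refine integral_congr_ae ?_
    filter_upwards [condMean_eq h] with q hq
    rw [← hq, hb_eq _ (h.ker.bd _)]
  have b := bd_phi h.ker
  have bb : Bd (fun z => 1 - phi (κ z) / Real.log 2) := by
    obtain ⟨c, hc⟩ := b.2
    refine ⟨measurable_const.sub (b.1.div_const _), 1 + c / |Real.log 2|, fun w => ?_⟩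
    refine (abs_sub _ _).trans ?_
    rw [abs_div, abs_one]
    gcongr; exact hc w
  rw [e1, int_Q1 h bb, integral_sub (integrable_const _) ((b.int l).div_const _), integral_div]
  simp
  field_simp

end
end RMP

open MeasureTheory ProbabilityTheory
set_option linter.unusedSectionVars false
set_option linter.unusedVariables false
namespace RMP
noncomputable section
variable {κ : ℝ → ℝ} {l P : Measure ℝ} [IsProbabilityMeasure l] [IsProbabilityMeasure P]
variable {ι : Type*} [Fintype ι] [DecidableEq ι]

lemma prob_unif {C : Finset (ι → ℝ)} (hC : IsCode C) : IsProbabilityMeasure (uniformOnFinset C) := by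
  constructor
  unfold uniformOnFinset
  have : C.card ≠ 0 := (Finset.card_pos.2 ⟨1, hC.one⟩).ne'
  simp only [Measure.smul_apply, Measure.finsetSum_apply, measure_univ, smul_eq_mul,
    Finset.sum_const, nsmul_eq_mul, mul_one]
  exact ENNReal.inv_mul_cancel (by simpa using this) (by simp)

lemma ae_unif (C : Finset (ι → ℝ)) : ∀ᵐ x ∂(uniformOnFinset C), x ∈ C := by
  unfold uniformOnFinset
  refine Measure.ae_smul_measure ?_ _
  rw [ae_iff, Measure.finsetSum_apply]
  refine Finset.sum_eq_zero fun x hx => ?_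
  rw [← ae_iff]
  refine (ae_dirac_iff (p := fun a => a ∈ C) C.measurableSet).2 ?_
  exact hx

variable {Ω : Type*} [MeasurableSpace Ω] {μ : Measure Ω} [IsProbabilityMeasure μ]

lemma ber_le (h : BMS κ l P) {C : Finset (ι → ℝ)} (hC : IsCode C)
    {X Z : Ω → (ι → ℝ)} (hX : Measurable X) (hZ : Measurable Z)
    (hlaw : Measure.map (fun ω => (X ω, Z ω)) μ
        = (uniformOnFinset C).prod (Measure.pi fun _ => P)) (i : ι) :
    BER μ (fun ω => X ω i) (fun ω => fun j => X ω j * Z ω j)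
      ≤ (1 - alpha κ C i (piM (fun _ => 1) P)) / 2 := by
  have := prob_unif hC
  have hpi : piM (fun _ : ι => 1) P = Measure.pi fun _ => P := by simp [piM, mix_one]
  have hXZ : Measurable fun ω => (X ω, Z ω) := hX.prodMk hZ
  have hmp : MeasurePreserving (fun ω => (X ω, Z ω)) μ
      ((uniformOnFinset C).prod (Measure.pi fun _ => P)) := ⟨hXZ, hlaw⟩
  have aeC' : ∀ᵐ q ∂((uniformOnFinset C).prod (Measure.pi fun _ : ι => P)), q.1 ∈ C :=
    Measure.quasiMeasurePreserving_fst.ae (ae_unif C)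
  have aeC : ∀ᵐ ω ∂μ, X ω ∈ C := hmp.quasiMeasurePreserving.ae aeC'
  set Y : Ω → (ι → ℝ) := fun ω => fun j => X ω j * Z ω j with hYdef
  have hY : Measurable Y := measurable_pi_lambda _ fun j =>
    ((measurable_pi_apply j).comp hX).mul ((measurable_pi_apply j).comp hZ)
  have hXi : Measurable fun ω => X ω i := (measurable_pi_apply i).comp hX
  have habs : ∀ x ∈ C, |x i| = 1 := by
    intro x hx
    rcases hC.sign x hx i with e | e <;> rw [e] <;> simp
  have iX : Integrable (fun ω => X ω i) μ := by
    refine Integrable.of_bound hXi.aestronglyMeasurable 1 ?_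
    filter_upwards [aeC] with ω hω
    rw [Real.norm_eq_abs, habs _ hω]
  have hW := measurable_Wc h.ker C i
  have hWY : StronglyMeasurable[MeasurableSpace.comap Y inferInstance] fun ω => Wc κ C i (Y ω) :=
    (hW.comp (comap_measurable Y)).stronglyMeasurable
  have hpull := condExp_stronglyMeasurable_mul_of_bound hY.comap_le hWY iX 1
    (Filter.Eventually.of_forall fun ω => by
      rw [Real.norm_eq_abs]; exact abs_Wc_le h.ker hC i _)
  have e1 : ∫ ω, Wc κ C i (Y ω) * X ω i ∂μ
      = ∫ ω, Wc κ C i (Y ω) * condMean μ (fun ω => X ω i) Y ω ∂μ := by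
    rw [← integral_condExp hY.comap_le]
    exact integral_congr_ae hpull
  have ic : Integrable (condMean μ (fun ω => X ω i) Y) μ := integrable_condExp
  have e2 : ∫ ω, Wc κ C i (Y ω) * condMean μ (fun ω => X ω i) Y ω ∂μ
      ≤ ∫ ω, |condMean μ (fun ω => X ω i) Y ω| ∂μ := by
    refine integral_mono (ic.bdd_mul (c := 1) (hW.comp hY).aestronglyMeasurable
      (Filter.Eventually.of_forall fun ω => abs_Wc_le h.ker hC i _)) ic.abs fun ω => ?_
    refine (le_abs_self _).trans ?_
    rw [abs_mul]
    exact mul_le_of_le_one_left (abs_nonneg _) (abs_Wc_le h.ker hC i _)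
  have e3 : ∫ ω, Wc κ C i (Y ω) * X ω i ∂μ = alpha κ C i (piM (fun _ => 1) P) := by
    rw [alpha_eq h hC, hpi]
    have m1 : Measurable fun q : (ι → ℝ) × (ι → ℝ) => Wc κ C i (q.1 * q.2) * q.1 i :=
      (hW.comp (measurable_fst.mul measurable_snd)).mul
        ((measurable_pi_apply i).comp measurable_fst)
    have s1 : ∫ ω, Wc κ C i (Y ω) * X ω i ∂μ
        = ∫ q, Wc κ C i (q.1 * q.2) * q.1 i ∂((uniformOnFinset C).prod (Measure.pi fun _ => P)) :=
      mp_integral hmp m1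
    have s2 : ∫ q, Wc κ C i (q.1 * q.2) * q.1 i ∂((uniformOnFinset C).prod (Measure.pi fun _ => P))
        = ∫ q, Wc κ C i q.2 ∂((uniformOnFinset C).prod (Measure.pi fun _ => P)) := by
      refine integral_congr_ae ?_
      filter_upwards [aeC'] with q hq
      rw [Wc_flip h.ker hC i hq, mul_assoc, mul_comm, mul_assoc, (hC.sign _ hq).sq, mul_one]
    rw [s1, s2]
    exact mp_integral measurePreserving_snd hW
  unfold BER
  rw [← e3, e1]
  linarith

end
end RMP
open RMP
/-- For an RM(r,m) code transmitted over a BMS channel with noise law `PZ`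
and capacity `C ∈ (0,1)`, if `R(r,m) < C` then for every coordinate `i`, the bit-error
rate of bit-MAP decoding satisfies `BER(X_i | Y) ≤ (ρ(m)/2)/(C − R(r,m))`. -/
theorem stmt_0
    {Ω : Type*} [MeasurableSpace Ω] (μ : Measure Ω) [IsProbabilityMeasure μ]
    (PZ : Measure ℝ) [IsProbabilityMeasure PZ]
    (hC0 : 0 < capacity PZ) (hC1 : capacity PZ < 1)
    (r m : ℕ) (hrm : r ≤ m) (hm : 1 ≤ m)
    (X Z : Ω → (Fin (2 ^ m) → ℝ)) (hX : Measurable X) (hZ : Measurable Z)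
    (hlaw : Measure.map (fun ω => (X ω, Z ω)) μ
        = (uniformOnFinset (bpskRM r m)).prod (Measure.pi fun _ => PZ))
    (hrate : RMrate r m < capacity PZ) :
    ∀ i : Fin (2 ^ m),
      BER μ (fun ω => X ω i) (fun ω => fun j => X ω j * Z ω j)
        ≤ (rho m / 2) / (capacity PZ - RMrate r m) := by
  intro i
  obtain ⟨κ, h⟩ := exists_BMS PZ
  rw [bpskRM_eq] at hlaw
  have hC := isCode_codeF (e := pt m) (fun _ => 1) r
  have hb := ber_le h hC hX hZ hlaw i
  refine hb.trans ?_
  have hd : 0 < capacity PZ - RMrate r m := by linarith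
  rw [div_div, mul_comm (2:ℝ), ← div_div]
  gcongr
  rw [le_div_iff₀ hd]
  have hR0 : 0 ≤ RMrate r m := by unfold RMrate; positivity
  have ha0 := alpha_nonneg (κ := κ) (C := codeF (pt m) (fun _ => 1) r) i (piM (fun _ => 1) PZ)
  have ha1 := alpha_le_one h.ker hC i (piM (fun _ => 1) PZ)
  rcases Nat.lt_or_ge m 2 with hm2 | hm2
  · obtain rfl : m = 1 := by omega
    have : rho 1 = 34 / 5 := by simp [rho]
    rw [this]
    nlinarith
  · have l2 : 0 < Real.log 2 := Real.log_pos (by norm_num)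
    have hcap := capacity_eq h
    have hq : (Fintype.card (Fin (2 ^ m)) : ℝ) * ∫ s, phi (κ s) ∂(symz PZ)
        - (∑ k ∈ Finset.range (r+1), (m.choose k:ℝ)) * Real.log 2
        = 2 ^ m * Real.log 2 * (capacity PZ - RMrate r m) := by
      rw [← hcap, Fintype.card_fin]
      unfold RMrate
      push_cast
      field_simp
    have key := code_ineq (e := pt m) h hm2 r i (by rw [hq]; positivity)
    rw [hq] at key
    have hbin := binom_real m r hm
    have hlog : 0 ≤ Real.log m := Real.log_natCast_nonneg m
    have hrho : 34 / (5 * Real.sqrt m) ≤ rho m := by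
      unfold rho; gcongr; linarith
    refine le_trans ?_ (hbin.trans hrho)
    rw [le_div_iff₀ (by positivity)]
    refine le_of_mul_le_mul_right ?_ l2
    linarith
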